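/- Let d ≥ 3, m ≥ 1, n = 1, q, t ∈ ℕ and s = 2q. Let P_1, …, P_s ∈ P^{1+m} be generic points, H_1 a generic point of P^{1+m}, H_2 ≅ P^{m-1} a generic hyperplane-in-codimension-2 linear space (dimension m−1), and W_1, …, W_t generic lines through H_1. Let X = dH_1 + H_2 + 2P_1 + ⋯ + 2P_s + W_1 + ⋯ + W_t ⊂ P^{1+m}. Then dim (I_X)_{d+1} = max{ 2·C(m+d, d) − 2q(m+2) − 2t ; 0 }. -/

import Mathlib

open MvPolynomial

noncomputable section

/-- The degree-`t` homogeneous piece of an ideal `I` of a polynomial ring, as a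
`K`-vector space; `Module.finrank K (piece K I t)` is `dim (I)_t`. -/
def piece (K : Type) [Field K] {ι : Type} (I : Ideal (MvPolynomial ι K)) (t : ℕ) :
    Submodule K (MvPolynomial ι K) :=
  Submodule.restrictScalars K I ⊓ MvPolynomial.homogeneousSubmodule ι K t

/-- The (saturated, radical) homogeneous ideal of the projective linear subspace spanned
by the set `S` of vectors: the ideal generated by all linear forms vanishing on `S`. -/
def linIdeal (K : Type) [Field K] {ι : Type} (S : Set (ι → K)) : Ideal (MvPolynomial ι K) :=
  Ideal.span { f | f ∈ MvPolynomial.homogeneousSubmodule ι K 1 ∧ ∀ x ∈ S, MvPolynomial.eval x f = 0 }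

section Openness

variable {K : Type*} [Field K]

/-- A linearly independent finite family of functions has a nonsingular square minor. -/
theorem exists_det_ne_zero_of_linearIndependent {r : ℕ} {I : Type*} (v : Fin r → I → K)
    (hv : LinearIndependent K v) :
    ∃ s : Fin r → I, (Matrix.of fun j k => v j (s k)).det ≠ 0 := by
  classical
  set w : I → Fin r → K := fun i j => v j i with hw
  have hspan : Submodule.span K (Set.range w) = ⊤ := by
    by_contra hne
    obtain ⟨f, hf0, hf⟩ := Submodule.exists_le_ker_of_lt_top _ (lt_top_iff_ne_top.mpr hne)
    apply hf0
    have h1 : ∀ i, f (w i) = 0 := fun i => by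
      have := hf (Submodule.subset_span ⟨i, rfl⟩)
      simpa using this
    have h2 : ∀ x : Fin r → K, f x = ∑ j, f (Pi.single j 1) * x j := by
      intro x
      conv_lhs => rw [← Finset.univ_sum_single x]
      rw [map_sum]
      refine Finset.sum_congr rfl fun j _ => ?_
      have : (Pi.single j (x j) : Fin r → K) = x j • Pi.single j 1 := by
        rw [← Pi.single_smul']; simp
      rw [this, map_smul, smul_eq_mul, mul_comm]
    have h3 : ∑ j, f (Pi.single j 1) • v j = 0 := by
      ext i
      have := h1 i
      rw [h2] at this
      simpa [Finset.sum_apply, hw] using this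
    have h4 := Fintype.linearIndependent_iff.mp hv _ h3
    ext j
    simpa using h4 j
  obtain ⟨κ, a, ha, hsp, hli⟩ := exists_linearIndependent' K w
  rw [hspan] at hsp
  let b := Module.Basis.mk hli (by rw [hsp])
  have : Finite κ := Module.Finite.finite_basis b
  have := Fintype.ofFinite κ
  have hc : Fintype.card κ = r := by
    have := Module.finrank_eq_card_basis b
    simpa using this.symm
  let eq : Fin r ≃ κ := (Fintype.equivFinOfCardEq hc).symm
  refine ⟨fun k => a (eq k), ?_⟩
  have hli' : LinearIndependent K (fun k => w (a (eq k))) := hli.comp _ eq.injective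
  have := (Matrix.linearIndependent_rows_iff_isUnit
    (A := (Matrix.of fun j k => v j (a (eq k))).transpose)).mp hli'
  rw [Matrix.isUnit_iff_isUnit_det, Matrix.det_transpose] at this
  exact this.ne_zero

/-- Semicontinuity of the kernel: if the entries of a family of linear maps lie in an algebra `A`
of functions, then the kernel dimension at a point bounds that on a principal open set. -/
theorem exists_mem_finrank_ker_le {X C I : Type*} [AddCommGroup C] [Module K C]
    [FiniteDimensional K C] (A : Subalgebra K (X → K)) (f : X → C →ₗ[K] (I → K))
    (hf : ∀ c i, (fun x => f x c i) ∈ A) (x₀ : X) :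
    ∃ g ∈ A, g x₀ ≠ 0 ∧ ∀ x, g x ≠ 0 →
      Module.finrank K (LinearMap.ker (f x)) ≤ Module.finrank K (LinearMap.ker (f x₀)) := by
  classical
  obtain ⟨D, hD⟩ := Submodule.exists_isCompl (LinearMap.ker (f x₀))
  let b := Module.finBasis K D
  have hinj : Function.Injective ((f x₀).domRestrict D) := by
    rw [← LinearMap.ker_eq_bot, LinearMap.ker_domRestrict]
    rw [Submodule.eq_bot_iff]
    rintro ⟨y, hy⟩ hy'
    have : y ∈ LinearMap.ker (f x₀) ⊓ D := ⟨by simpa using hy', hy⟩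
    rw [hD.inf_eq_bot] at this
    simpa using this
  have hli : LinearIndependent K (fun j => f x₀ (b j : C)) :=
    b.linearIndependent.map' ((f x₀).domRestrict D) (LinearMap.ker_eq_bot.mpr hinj)
  obtain ⟨s, hs⟩ := exists_det_ne_zero_of_linearIndependent _ hli
  refine ⟨fun x => (Matrix.of fun j k => f x (b j : C) (s k)).det, ?_, hs, ?_⟩
  · have : (fun x => (Matrix.of fun j k => f x (b j : C) (s k)).det) =
        ∑ σ : Equiv.Perm (Fin (Module.finrank K D)), (Equiv.Perm.sign σ : ℤ) •
          ∏ i, (fun x => f x (b (σ i) : C) (s i)) := by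
      funext x
      rw [Matrix.det_apply]
      simp [Finset.sum_apply, Finset.prod_apply, Units.smul_def]
    rw [this]
    refine sum_mem fun σ _ => zsmul_mem (prod_mem fun i _ => hf _ _) _
  · intro x hx
    have hdisj : LinearMap.ker (f x) ⊓ D = ⊥ := by
      rw [Submodule.eq_bot_iff]
      rintro y ⟨hy, hyD⟩
      have h1 : ∑ j, b.repr ⟨y, hyD⟩ j • (b j : C) = y := by
        have := congrArg (Submodule.subtype D) (b.sum_repr ⟨y, hyD⟩)
        simpa only [map_sum, map_smul, Submodule.subtype_apply] using this
      have h2 : Matrix.vecMul (fun j => b.repr ⟨y, hyD⟩ j)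
          (Matrix.of fun j k => f x (b j : C) (s k)) = 0 := by
        funext k
        have : f x y (s k) = 0 := by
          rw [LinearMap.mem_ker.mp hy]; rfl
        rw [← h1, map_sum] at this
        simpa [Matrix.vecMul, dotProduct, Finset.sum_apply] using this
      have h3 := Matrix.eq_zero_of_vecMul_eq_zero hx h2
      rw [← h1]
      exact Finset.sum_eq_zero fun j _ => by
        rw [show b.repr ⟨y, hyD⟩ j = 0 from congrFun h3 j, zero_smul]
    have h1 := Submodule.finrank_add_finrank_le_of_disjoint (disjoint_iff.mpr hdisj)
    have h2 := Submodule.finrank_add_eq_of_isCompl hD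
    omega

variable (K) in
/-- The polynomial functions in one variable. -/
def polyFun : Subalgebra K (K → K) := (Polynomial.aeval (id : K → K)).range

theorem mem_polyFun {f : K → K} : f ∈ polyFun K ↔ ∃ p : Polynomial K, ∀ τ, f τ = p.eval τ := by
  have key : ∀ (p : Polynomial K) (τ : K), (Polynomial.aeval (id : K → K) p) τ = p.eval τ := by
    intro p τ
    induction p using Polynomial.induction_on' with
    | add p q hp hq => simp only [map_add, Pi.add_apply, hp, hq, Polynomial.eval_add]
    | monomial n a => simp [Polynomial.aeval_monomial]
  constructor
  · rintro ⟨p, rfl⟩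
    exact ⟨p, fun τ => key p τ⟩
  · rintro ⟨p, hp⟩
    exact ⟨p, funext fun τ => by rw [hp]; exact key p τ⟩

variable {E F : Type*} [AddCommGroup E] [Module K E] [AddCommGroup F] [Module K F]

variable (K E) in
/-- The functions whose restriction to every line is polynomial. -/
def linePoly : Subalgebra K (E → K) where
  carrier := {g | ∀ x v : E, (fun τ : K => g (x + τ • v)) ∈ polyFun K}
  mul_mem' ha hb x v := mul_mem (ha x v) (hb x v)
  add_mem' ha hb x v := add_mem (ha x v) (hb x v)
  algebraMap_mem' r _ _ := algebraMap_mem (polyFun K) r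

theorem linearMap_mem_linePoly (φ : E →ₗ[K] K) : (fun x => φ x) ∈ linePoly K E := by
  intro x v
  rw [mem_polyFun]
  exact ⟨Polynomial.C (φ x) + Polynomial.X * Polynomial.C (φ v), fun τ => by
    simp only [map_add, map_smul, smul_eq_mul, Polynomial.eval_add, Polynomial.eval_mul,
      Polynomial.eval_C, Polynomial.eval_X]⟩

variable (K) in
/-- A property that, once it holds at a point, fails only finitely often on each line through
that point. -/
def LineOpen (P : E → Prop) : Prop := ∀ x v, P x → {τ : K | ¬ P (x + τ • v)}.Finite

theorem LineOpen.and {P Q : E → Prop} (hP : LineOpen K P) (hQ : LineOpen K Q) :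
    LineOpen K fun x => P x ∧ Q x := by
  rintro x v ⟨h1, h2⟩
  refine ((hP x v h1).union (hQ x v h2)).subset fun τ hτ => ?_
  by_contra h
  simp only [Set.mem_union, Set.mem_ofPred_eq, not_or, not_not] at h
  exact hτ h

theorem LineOpen.comp {P : F → Prop} (hP : LineOpen K P) (φ : E →ₗ[K] F) :
    LineOpen K fun x => P (φ x) := by
  intro x v h
  simpa using hP (φ x) (φ v) h

theorem LineOpen.forall {ι : Type*} [Finite ι] {P : ι → E → Prop} (hP : ∀ i, LineOpen K (P i)) :
    LineOpen K fun x => ∀ i, P i x := by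
  intro x v h
  refine (Set.finite_iUnion fun i => hP i x v (h i)).subset fun τ hτ => ?_
  simpa using hτ

theorem lineOpen_ne_zero [Infinite K] {g : E → K} (hg : g ∈ linePoly K E) :
    LineOpen K fun x => g x ≠ 0 := by
  classical
  intro x v h
  obtain ⟨p, hp⟩ := mem_polyFun.mp (hg x v)
  have hp0 : p ≠ 0 := by
    rintro rfl
    exact h (by simpa using hp 0)
  refine (p.roots.toFinset.finite_toSet).subset fun τ hτ => ?_
  simp only [Set.mem_ofPred_eq, not_not] at hτ
  simpa [hp0, ← hp] using hτ

theorem LineOpen.exists_and_mem [Infinite K] {P Q : E → Prop} (hP : LineOpen K P)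
    (hQ : LineOpen K Q) (V : Submodule K E) (h₁ : ∃ x ∈ V, P x) (h₂ : ∃ x ∈ V, Q x) :
    ∃ x ∈ V, P x ∧ Q x := by
  obtain ⟨x, hxV, hx⟩ := h₁
  obtain ⟨y, hyV, hy⟩ := h₂
  have f1 := hP x (y - x) hx
  have f2 := (hQ y (x - y) hy).preimage
    (f := fun τ : K => 1 - τ) (fun a _ b _ h => by simpa using h)
  obtain ⟨τ, hτ⟩ := (f1.union f2).exists_notMem
  simp only [Set.mem_union, Set.mem_ofPred_eq, Set.mem_preimage, not_or, not_not] at hτ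
  refine ⟨x + τ • (y - x), V.add_mem hxV (V.smul_mem _ (V.sub_mem hyV hxV)), hτ.1, ?_⟩
  have : y + (1 - τ) • (x - y) = x + τ • (y - x) := by module
  rw [← this]; exact hτ.2

theorem LineOpen.exists_and [Infinite K] {P Q : E → Prop} (hP : LineOpen K P)
    (hQ : LineOpen K Q) (h₁ : ∃ x, P x) (h₂ : ∃ x, Q x) : ∃ x, P x ∧ Q x := by
  obtain ⟨x, -, hx⟩ := hP.exists_and_mem hQ ⊤ (by simpa using h₁) (by simpa using h₂)
  exact ⟨x, hx⟩

theorem lineOpen_finrank_ker_le [Infinite K] {C I : Type*} [AddCommGroup C] [Module K C]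
    [FiniteDimensional K C] (f : E → C →ₗ[K] (I → K))
    (hf : ∀ c i, (fun x => f x c i) ∈ linePoly K E) (δ : ℕ) :
    LineOpen K fun x => Module.finrank K (LinearMap.ker (f x)) ≤ δ := by
  classical
  intro x v h
  obtain ⟨g, hgA, hg0, hg⟩ := exists_mem_finrank_ker_le (polyFun K) (fun τ => f (x + τ • v))
    (fun c i => hf c i x v) 0
  obtain ⟨p, hp⟩ := mem_polyFun.mp hgA
  have hp0 : p ≠ 0 := by
    rintro rfl
    exact hg0 (by simpa using hp 0)
  refine (p.roots.toFinset.finite_toSet).subset fun τ hτ => ?_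
  simp only [Set.mem_ofPred_eq, not_le] at hτ
  by_contra hne
  have hgτ : g τ ≠ 0 := by
    rw [hp]; simpa [hp0] using hne
  have h0 : x + (0 : K) • v = x := by simp
  have := hg τ hgτ
  beta_reduce at this
  rw [h0] at this
  omega

end Openness

section Tangent

variable {K : Type*} [Field K]

theorem finrank_le_of_injOn {V W : Type*} [AddCommGroup V] [Module K V]
    [AddCommGroup W] [Module K W] {S : Submodule K V} {T : Submodule K W} [FiniteDimensional K T]
    (φ : V →ₗ[K] W) (hφ : ∀ x ∈ S, φ x = 0 → x = 0) (h : ∀ x ∈ S, φ x ∈ T) :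
    Module.finrank K S ≤ Module.finrank K T := by
  refine LinearMap.finrank_le_finrank_of_injective (f := φ.restrict (p := S) (q := T) h) ?_
  refine (injective_iff_map_eq_zero _).mpr fun x hx => Subtype.ext ?_
  exact hφ x x.2 (congrArg Subtype.val hx)

theorem finrank_le_finrank_inf_ker_add {V W : Type*} [AddCommGroup V] [Module K V]
    [AddCommGroup W] [Module K W] (S : Submodule K V) [FiniteDimensional K S] (g : V →ₗ[K] W) :
    Module.finrank K S ≤
      Module.finrank K (S ⊓ LinearMap.ker g : Submodule K V) + Module.finrank K (S.map g) := by
  have h := LinearMap.finrank_range_add_finrank_ker (g.domRestrict S)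
  rw [LinearMap.range_domRestrict] at h
  have h2 : Module.finrank K (LinearMap.ker (g.domRestrict S)) ≤
      Module.finrank K (S ⊓ LinearMap.ker g : Submodule K V) := by
    have : FiniteDimensional K (S ⊓ LinearMap.ker g : Submodule K V) :=
      Submodule.finiteDimensional_inf_left _ _
    exact finrank_le_of_injOn S.subtype (fun x _ hx => Subtype.ext hx) fun x hx => ⟨x.2, hx⟩
  omega

variable {J J' ι ι' : Type*} [Fintype J] [Fintype J'] [Fintype ι] [Fintype ι']

/-- The parametrization of the span of the tangent spaces at `p j` to the Veronese variety of
degree `e + 1`, whose elements are viewed as functions. -/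
def veroneseTangent (e : ℕ) (p : J → ι → K) : (J → ι → K) →ₗ[K] ((ι → K) → K) where
  toFun c y := ∑ j, (p j ⬝ᵥ y) ^ e * (c j ⬝ᵥ y)
  map_add' c c' := by
    funext y
    simp [mul_add, Finset.sum_add_distrib, add_dotProduct]
  map_smul' r c := by
    funext y
    simp only [Pi.smul_apply, smul_dotProduct, smul_eq_mul, RingHom.id_apply, Finset.mul_sum]
    exact Finset.sum_congr rfl fun j _ => by ring

theorem veroneseTangent_apply (e : ℕ) (p c : J → ι → K) (y : ι → K) :
    veroneseTangent e p c y = ∑ j, (p j ⬝ᵥ y) ^ e * (c j ⬝ᵥ y) := rfl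

variable (K) in
/-- Some `q` points of `K ^ n` have degree `e + 1` tangent spaces whose sum has dimension at
least `q * n - δ`. -/
def HasDefect (e n q δ : ℕ) : Prop :=
  ∃ p : Fin q → Fin n → K, Module.finrank K (LinearMap.ker (veroneseTangent e p)) ≤ δ

theorem finrank_ker_le_zero {C D : Type*} [AddCommGroup C] [Module K C] [FiniteDimensional K C]
    [AddCommGroup D] [Module K D] (f : C →ₗ[K] D) :
    Module.finrank K (LinearMap.ker f) ≤ 0 ↔ ∀ c, f c = 0 → c = 0 := by
  rw [Nat.le_zero, Submodule.finrank_eq_zero, LinearMap.ker_eq_bot']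

theorem hasDefect_of_equiv {e n q δ : ℕ} (σ : J ≃ Fin q) (τ : ι ≃ Fin n) (p : J → ι → K)
    (h : Module.finrank K (LinearMap.ker (veroneseTangent e p)) ≤ δ) : HasDefect K e n q δ := by
  refine ⟨fun j i => p (σ.symm j) (τ.symm i), le_trans ?_ h⟩
  have hd : ∀ (c : Fin n → K) (y : ι → K), c ⬝ᵥ (y ∘ τ.symm) = (c ∘ τ) ⬝ᵥ y := by
    intro c y
    simp only [dotProduct, Function.comp]
    exact (Equiv.sum_comp τ fun i => c i * y (τ.symm i)).symm.trans (by simp)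
  let φ : (Fin q → Fin n → K) →ₗ[K] (J → ι → K) :=
    { toFun := fun c j i => c (σ j) (τ i)
      map_add' := fun _ _ => rfl
      map_smul' := fun _ _ => rfl }
  refine finrank_le_of_injOn φ ?_ ?_
  · intro c _ hc
    funext j i
    simpa [φ] using congrFun (congrFun hc (σ.symm j)) (τ.symm i)
  · intro c hc
    rw [LinearMap.mem_ker]
    funext y
    have := congrFun (LinearMap.mem_ker.mp hc) (y ∘ τ.symm)
    rw [veroneseTangent_apply, Pi.zero_apply, ← Equiv.sum_comp σ] at this
    rw [veroneseTangent_apply, Pi.zero_apply, ← this]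
    refine Finset.sum_congr rfl fun j _ => ?_
    rw [hd, hd]
    congr 3
    · funext i; simp

theorem HasDefect.mono_card {e n q q' : ℕ} (h : HasDefect K e n q 0) (hq : q' ≤ q) :
    HasDefect K e n q' 0 := by
  obtain ⟨p, hp⟩ := h
  rw [finrank_ker_le_zero] at hp
  refine ⟨fun j => p (Fin.castLE hq j), ?_⟩
  rw [finrank_ker_le_zero]
  intro c hc
  have h0 := hp (fun j => if hj : (j : ℕ) < q' then c ⟨j, hj⟩ else 0) (by
    funext y
    rw [← hc, veroneseTangent_apply, veroneseTangent_apply]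
    refine (Finset.sum_of_injOn (Fin.castLE hq) (Fin.castLE_injective hq).injOn (by simp)
      ?_ ?_).symm
    · intro j _ hj
      have : ¬ (j : ℕ) < q' := fun hlt => hj ⟨⟨j, hlt⟩, by simp, rfl⟩
      simp [this]
    · intro j _
      simp)
  funext j
  simpa using congrFun h0 (Fin.castLE hq j)

theorem HasDefect.mono_right {e n q δ δ' : ℕ} (h : HasDefect K e n q δ) (hδ : δ ≤ δ') :
    HasDefect K e n q δ' := by
  obtain ⟨p, hp⟩ := h
  exact ⟨p, hp.trans hδ⟩

theorem HasDefect.add_card {e n k δ : ℕ} (r : ℕ) (h : HasDefect K e n k δ) :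
    HasDefect K e n (k + r) (δ + r * n) := by
  obtain ⟨p, hp⟩ := h
  refine hasDefect_of_equiv (J := Fin k ⊕ Fin r) finSumFinEquiv (Equiv.refl _)
    (Sum.elim p fun _ => 0) ?_
  let ρ : (Fin k ⊕ Fin r → Fin n → K) →ₗ[K] (Fin r → Fin n → K) :=
    { toFun := fun c j => c (Sum.inr j)
      map_add' := fun _ _ => rfl
      map_smul' := fun _ _ => rfl }
  let φ : (Fin k ⊕ Fin r → Fin n → K) →ₗ[K] (Fin k → Fin n → K) :=
    { toFun := fun c j => c (Sum.inl j)
      map_add' := fun _ _ => rfl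
      map_smul' := fun _ _ => rfl }
  have h1 := finrank_le_finrank_inf_ker_add
    (LinearMap.ker (veroneseTangent e (Sum.elim p fun _ : Fin r => (0 : Fin n → K)))) ρ
  have h2 : Module.finrank K (Submodule.map ρ (LinearMap.ker
      (veroneseTangent e (Sum.elim p fun _ : Fin r => (0 : Fin n → K))))) ≤ r * n := by
    refine (Submodule.finrank_le _).trans ?_
    simp [Module.finrank_pi_fintype]
  have h3 : Module.finrank K (LinearMap.ker (veroneseTangent e
      (Sum.elim p fun _ : Fin r => (0 : Fin n → K))) ⊓ LinearMap.ker ρ : Submodule K _) ≤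
      Module.finrank K (LinearMap.ker (veroneseTangent e p)) := by
    refine finrank_le_of_injOn φ ?_ ?_
    · rintro c ⟨-, hc'⟩ hc
      funext j
      rcases j with j | j
      · exact congrFun hc j
      · exact congrFun (LinearMap.mem_ker.mp hc') j
    · rintro c ⟨hc, hc'⟩
      have hc'' : ∀ j, c (Sum.inr j) = 0 := fun j => congrFun (LinearMap.mem_ker.mp hc') j
      refine LinearMap.mem_ker.mpr (funext fun y => ?_)
      have := congrFun (LinearMap.mem_ker.mp hc) y
      simpa [veroneseTangent_apply, hc'', φ] using this
  omega

omit [Fintype J] in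
theorem dotProduct_mem_linePoly (j : J) (y : ι → K) :
    (fun p : J → ι → K => p j ⬝ᵥ y) ∈ linePoly K (J → ι → K) :=
  linearMap_mem_linePoly
    { toFun := fun p : J → ι → K => p j ⬝ᵥ y
      map_add' := fun a b => by simp [add_dotProduct]
      map_smul' := fun a b => by simp [smul_dotProduct] }

theorem veroneseTangent_mem_linePoly (e : ℕ) (c : J → ι → K) (y : ι → K) :
    (fun p : J → ι → K => veroneseTangent e p c y) ∈ linePoly K (J → ι → K) := by
  have : (fun p : J → ι → K => veroneseTangent e p c y) =
      ∑ j, (c j ⬝ᵥ y) • (fun p : J → ι → K => p j ⬝ᵥ y) ^ e := by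
    funext p
    simp [veroneseTangent_apply, Finset.sum_apply, mul_comm]
  rw [this]
  exact sum_mem fun j _ => Subalgebra.smul_mem _ (pow_mem (dotProduct_mem_linePoly j y) e) _

theorem lineOpen_veroneseTangent [Infinite K] (e δ : ℕ) :
    LineOpen K fun p : J → ι → K =>
      Module.finrank K (LinearMap.ker (veroneseTangent e p)) ≤ δ :=
  lineOpen_finrank_ker_le (E := J → ι → K) (C := J → ι → K) (I := ι → K)
    (fun p => veroneseTangent e p) (fun c y => veroneseTangent_mem_linePoly e c y) δ

omit [Fintype J] [Fintype ι] in
theorem lineOpen_coord_ne_zero [Infinite K] (j : J) (i : ι) :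
    LineOpen K fun p : J → ι → K => p j i ≠ 0 :=
  lineOpen_ne_zero (linearMap_mem_linePoly
    { toFun := fun p : J → ι → K => p j i
      map_add' := fun _ _ => rfl
      map_smul' := fun _ _ => rfl })

/-- Differentiation of an identity between polynomial functions along a line. -/
theorem derivative_of_forall_eval_eq [Infinite K] (P : Polynomial K) (r : K)
    (h : ∀ τ, P.eval τ = r) : P.derivative = 0 := by
  have : P = Polynomial.C r := Polynomial.funext fun τ => by simp [h]
  rw [this, Polynomial.derivative_C]

theorem sum_pow_mul_directional [Infinite K] (e : ℕ) (p c : J → ι → K) (u : ι → K)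
    (h : ∀ y : ι → K, ∀ τ : K, veroneseTangent (e + 1) p c (y + τ • u) =
      veroneseTangent (e + 1) p c y) :
    veroneseTangent e p (fun j => ((e + 1 : ℕ) * (p j ⬝ᵥ u) : K) • c j + (c j ⬝ᵥ u) • p j) = 0 := by
  funext y
  set P : Polynomial K := ∑ j, (Polynomial.C (p j ⬝ᵥ y) + Polynomial.C (p j ⬝ᵥ u) * Polynomial.X) ^
    (e + 1) * (Polynomial.C (c j ⬝ᵥ y) + Polynomial.C (c j ⬝ᵥ u) * Polynomial.X) with hP
  have h0 := derivative_of_forall_eval_eq P (veroneseTangent (e + 1) p c y) fun τ => by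
    rw [← h y τ, veroneseTangent_apply, hP, Polynomial.eval_finsetSum]
    refine Finset.sum_congr rfl fun j _ => ?_
    simp [dotProduct_add, dotProduct_smul, mul_comm τ]
  have h1 := congrArg (Polynomial.eval 0) h0
  rw [hP, Polynomial.derivative_sum, Polynomial.eval_finsetSum, Polynomial.eval_zero] at h1
  rw [veroneseTangent_apply, Pi.zero_apply, ← h1]
  refine Finset.sum_congr rfl fun j _ => ?_
  simp [Polynomial.derivative_pow, Polynomial.derivative_mul, add_dotProduct, smul_dotProduct]
  ring

theorem sum_mul_pow_directional [Infinite K] [CharZero K] (N : ℕ) (l : J → ι → K) (b : J → K)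
    (h : ∀ y, ∑ j, b j * (l j ⬝ᵥ y) ^ (N + 1) = 0) (u : ι → K) (y : ι → K) :
    ∑ j, (b j * (l j ⬝ᵥ u)) * (l j ⬝ᵥ y) ^ N = 0 := by
  set P : Polynomial K := ∑ j, Polynomial.C (b j) *
    (Polynomial.C (l j ⬝ᵥ y) + Polynomial.C (l j ⬝ᵥ u) * Polynomial.X) ^ (N + 1) with hP
  have h0 := derivative_of_forall_eval_eq P 0 fun τ => by
    rw [← h (y + τ • u), hP, Polynomial.eval_finsetSum]
    refine Finset.sum_congr rfl fun j _ => ?_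
    simp [dotProduct_add, dotProduct_smul, mul_comm τ]
  have h1 := congrArg (Polynomial.eval 0) h0
  rw [hP, Polynomial.derivative_sum, Polynomial.eval_finsetSum, Polynomial.eval_zero] at h1
  have h2 : ((N + 1 : ℕ) : K) * ∑ j, (b j * (l j ⬝ᵥ u)) * (l j ⬝ᵥ y) ^ N = 0 := by
    rw [← h1, Finset.mul_sum]
    refine Finset.sum_congr rfl fun j _ => ?_
    simp [Polynomial.derivative_pow]
    ring
  exact (mul_eq_zero.mp h2).resolve_left (by exact_mod_cast N.succ_ne_zero)

theorem sum_mul_multiset_prod_eq_zero [DecidableEq ι] [CharZero K] (l : J → ι → K)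
    (s : Multiset ι) :
    ∀ b : J → K, (∀ y, ∑ j, b j * (l j ⬝ᵥ y) ^ s.card = 0) →
      ∑ j, b j * (s.map (l j)).prod = 0 := by
  induction s using Multiset.induction with
  | empty => intro b h; simpa using h 0
  | cons i s ih =>
    intro b h
    rw [Multiset.card_cons] at h
    have := ih (fun j => b j * (l j ⬝ᵥ Pi.single i 1)) fun y =>
      sum_mul_pow_directional _ l b h _ y
    simpa [mul_assoc] using this

omit [Fintype ι] in
theorem linearIndependent_monomial_fun [Infinite K] [DecidableEq ι] (N : ℕ) :
    LinearIndependent K fun (s : Sym ι N) (x : ι → K) => ((s : Multiset ι).map x).prod := by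
  have h1 : LinearIndependent K fun s : Sym ι N =>
      (monomial (Multiset.toFinsupp (s : Multiset ι)) (1 : K) : MvPolynomial ι K) := by
    have := (MvPolynomial.basisMonomials ι K).linearIndependent.comp
      (fun s : Sym ι N => Multiset.toFinsupp (s : Multiset ι))
      (fun s t h => Subtype.ext (Multiset.toFinsupp.injective h))
    simpa [Function.comp_def] using this
  let ev : MvPolynomial ι K →ₗ[K] ((ι → K) → K) :=
    { toFun := fun F x => eval x F
      map_add' := fun _ _ => by funext; simp
      map_smul' := fun _ _ => by funext; simp }
  have h2 := h1.map' ev (LinearMap.ker_eq_bot.mpr fun F G h =>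
    MvPolynomial.funext fun x => congrFun h x)
  have h3 : (fun (s : Sym ι N) (x : ι → K) => ((s : Multiset ι).map x).prod) =
      ev ∘ fun s : Sym ι N => monomial (Multiset.toFinsupp (s : Multiset ι)) (1 : K) := ?_
  · rw [h3]
    exact h2
  funext s x
  simp only [ev, LinearMap.coe_mk, AddHom.coe_mk, eval_monomial, one_mul, Function.comp]
  rw [Finsupp.prod, Finset.prod_multiset_map_count]
  simp

/-- There are as many linearly independent powers of linear forms as monomials. -/
theorem exists_linearIndependent_pow [CharZero K] (n N : ℕ) :
    ∃ l : Fin (n.multichoose N) → Fin n → K,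
      LinearIndependent K fun k (y : Fin n → K) => (l k ⬝ᵥ y) ^ N := by
  have : Fintype.card (Sym (Fin n) N) = n.multichoose N := by
    rw [Sym.card_sym_eq_multichoose, Fintype.card_fin]
  let eq := (Fintype.equivFinOfCardEq this).symm
  obtain ⟨l, hl⟩ := exists_det_ne_zero_of_linearIndependent _
    ((linearIndependent_monomial_fun (K := K) (ι := Fin n) N).comp eq eq.injective)
  refine ⟨l, Fintype.linearIndependent_iff.mpr fun b hb => ?_⟩
  have hb' : ∀ y, ∑ k, b k * (l k ⬝ᵥ y) ^ N = 0 := fun y => by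
    simpa [Finset.sum_apply] using congrFun hb y
  have : (Matrix.of fun j k => ((eq j : Multiset (Fin n)).map (l k)).prod).mulVec b = 0 := by
    funext j
    have := sum_mul_multiset_prod_eq_zero l (eq j : Multiset (Fin n)) b (by simpa using hb')
    simpa [Matrix.mulVec, dotProduct, mul_comm] using this
  exact congrFun (Matrix.eq_zero_of_mulVec_eq_zero hl this)

end Tangent

section Horace

variable {K : Type*} [Field K] [CharZero K]

omit [CharZero K] in
theorem sum_pow_mul_single_add_single {ι : Type*} [Fintype ι] [DecidableEq ι] {e : ℕ} (he : 1 ≤ e)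
    (C : ι → ι → K) {a b : ι} (hab : a ≠ b) (s r : K) :
    veroneseTangent e (fun i => Pi.single i 1) C (Pi.single a s + Pi.single b r) =
      s ^ e * (s * C a a + r * C a b) + r ^ e * (s * C b a + r * C b b) := by
  rw [veroneseTangent_apply, Fintype.sum_eq_add a b hab]
  · simp [dotProduct_add, hab, hab.symm, mul_comm]
  · rintro x ⟨hxa, hxb⟩
    have : e ≠ 0 := by omega
    simp [dotProduct_add, hxa, hxb, this]

omit [CharZero K] in
theorem coord_relations {ι : Type*} [Fintype ι] [DecidableEq ι] {e : ℕ} (he : 1 ≤ e)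
    (C : ι → ι → K) (h : veroneseTangent e (fun i => Pi.single i 1) C = 0) {a b : ι} (hab : a ≠ b) :
    C a a = 0 ∧ ∀ s r : K, s ^ e * (r * C a b) + r ^ e * (s * C b a) = 0 := by
  have he' : e ≠ 0 := by omega
  have key := fun s r => (sum_pow_mul_single_add_single he C hab s r).symm.trans (congrFun h _)
  have ha : C a a = 0 := by simpa [he'] using key 1 0
  have hb : C b b = 0 := by simpa [he'] using key 0 1
  exact ⟨ha, fun s r => by simpa [ha, hb] using key s r⟩

omit [CharZero K] in
theorem hasDefect_one_point (e n : ℕ) : HasDefect K e (n + 1) 1 0 := by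
  refine ⟨fun _ => Pi.single 0 1, (finrank_ker_le_zero _).mpr fun c hc => ?_⟩
  have key : ∀ y : Fin (n + 1) → K, y 0 ^ e * (c 0 ⬝ᵥ y) = 0 := fun y => by
    simpa [veroneseTangent_apply] using congrFun hc y
  have h0 : c 0 0 = 0 := by simpa using key (Pi.single 0 1)
  funext j i
  rw [Subsingleton.elim j 0]
  by_cases hi : i = 0
  · subst hi; exact h0
  · have h1 : (Pi.single 0 1 + Pi.single i 1 : Fin (n + 1) → K) 0 = 1 := by simp [Ne.symm hi]
    have := key (Pi.single 0 1 + Pi.single i 1)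
    rw [h1] at this
    simpa [dotProduct_add, h0] using this

omit [CharZero K] in
theorem hasDefect_quadric {k n : ℕ} (h : k ≤ n) : HasDefect K 1 n k (k * (k - 1) / 2) := by
  refine ⟨fun j => Pi.single (Fin.castLE h j) 1, ?_⟩
  have hrel : ∀ c : Fin k → Fin n → K,
      veroneseTangent 1 (fun j => Pi.single (Fin.castLE h j) 1) c = 0 →
      veroneseTangent 1 (fun i : Fin n => Pi.single i 1)
        (fun a => if ha : (a : ℕ) < k then c ⟨a, ha⟩ else 0) = 0 := by
    intro c hc
    funext y
    rw [← hc, veroneseTangent_apply, veroneseTangent_apply]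
    refine (Finset.sum_of_injOn (Fin.castLE h) (Fin.castLE_injective h).injOn (by simp) ?_ ?_).symm
    · intro j _ hj
      have : ¬ (j : ℕ) < k := fun hlt => hj ⟨⟨j, hlt⟩, by simp, rfl⟩
      simp [this]
    · intro j _
      simp
  let φ : (Fin k → Fin n → K) →ₗ[K] ((j : Fin k) → Fin j → K) :=
    { toFun := fun c j i => c j ⟨i, by omega⟩
      map_add' := fun _ _ => rfl
      map_smul' := fun _ _ => rfl }
  have h1 : Module.finrank K ((j : Fin k) → Fin j → K) = k * (k - 1) / 2 := by
    rw [Module.finrank_pi_fintype, ← Finset.sum_range_id, ← Fin.sum_univ_eq_sum_range]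
    simp
  rw [← h1, ← finrank_top K ((j : Fin k) → Fin j → K)]
  refine finrank_le_of_injOn φ (fun c hc h0 => ?_) fun _ _ => Submodule.mem_top
  have hC := hrel c (LinearMap.mem_ker.mp hc)
  have hlt : ∀ (j : Fin k) (i : Fin n), i.val < j.val → c j i = 0 := fun j i hij =>
    congrFun (congrFun h0 j) ⟨i, hij⟩
  have hgt : ∀ (j : Fin k) (i : Fin n), j.val < i.val → c j i = 0 := by
    intro j i hij
    have hne : Fin.castLE h j ≠ i := fun hji => by simp [← hji] at hij
    have := (coord_relations le_rfl _ hC hne).2 1 1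
    by_cases hik : i.val < k
    · simpa [hik, hlt ⟨i, hik⟩ (Fin.castLE h j) hij] using this
    · simpa [hik] using this
  have hdiag : ∀ j : Fin k, c j (Fin.castLE h j) = 0 := by
    intro j
    by_cases hex : ∃ b : Fin n, Fin.castLE h j ≠ b
    · obtain ⟨b, hb⟩ := hex
      simpa using (coord_relations le_rfl _ hC hb).1
    · push Not at hex
      have := congrFun hC (Pi.single (Fin.castLE h j) 1)
      rw [veroneseTangent_apply, Finset.sum_eq_single (Fin.castLE h j)
        (fun b _ hb => absurd (hex b).symm hb) (by simp)] at this
      simpa using this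
  funext j i
  rcases lt_trichotomy i.val j.val with hij | hij | hij
  · exact hlt j i hij
  · rw [show i = Fin.castLE h j from Fin.ext hij]; exact hdiag j
  · exact hgt j i hij

omit [CharZero K] in
theorem cons_zero_dotProduct {n : ℕ} (l : Fin n → K) (y : Fin (n + 1) → K) :
    (Fin.cons 0 l : Fin (n + 1) → K) ⬝ᵥ y = l ⬝ᵥ Fin.tail y := by
  simp [dotProduct, Fin.sum_univ_succ, Fin.tail]

/-- The polar twist of `c` by `g` in the direction of the first coordinate. -/
def polarTwist {k n : ℕ} (e : ℕ) (g : Fin k → Fin (n + 1) → K) :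
    (Fin k → Fin (n + 1) → K) →ₗ[K] (Fin k → Fin (n + 1) → K) where
  toFun c j := ((e + 1 : ℕ) * g j 0 : K) • c j + c j 0 • g j
  map_add' c c' := by
    funext j i
    simp
    ring
  map_smul' r c := by
    funext j i
    simp
    ring

theorem polarTwist_injective {k n e : ℕ} {g : Fin k → Fin (n + 1) → K} (hg : ∀ j, g j 0 ≠ 0)
    (c : Fin k → Fin (n + 1) → K) (h : polarTwist e g c = 0) : c = 0 := by
  have h1 : ∀ j i, ((e + 1 : ℕ) * g j 0 : K) * c j i + c j 0 * g j i = 0 := fun j i =>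
    congrFun (congrFun h j) i
  funext j i
  have he : ((e + 2 : ℕ) : K) ≠ 0 := by exact_mod_cast (Nat.succ_ne_zero (e + 1))
  have he' : ((e + 1 : ℕ) : K) ≠ 0 := by exact_mod_cast (Nat.succ_ne_zero e)
  have h0 : c j 0 = 0 := by
    have h2 : ((e + 2 : ℕ) : K) * (g j 0 * c j 0) = 0 := by
      have := h1 j 0
      push_cast at this ⊢
      linear_combination this
    exact (mul_eq_zero.mp ((mul_eq_zero.mp h2).resolve_left he)).resolve_left (hg j)
  have := h1 j i
  rw [h0, zero_mul, add_zero] at this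
  exact (mul_eq_zero.mp this).resolve_left (mul_ne_zero he' (hg j))

theorem exists_pow_linearIndependent_mod {n N u δ : ℕ} {D : Type*} [AddCommGroup D] [Module K D]
    (T : D →ₗ[K] ((Fin (n + 1) → K) → K))
    (hT : ∀ c, T c = 0 → c = 0)
    [FiniteDimensional K D]
    (hδ : ∀ S : Submodule K ((Fin (n + 1) → K) → K),
      (∀ f ∈ S, ∀ y (τ : K), f (y + τ • Pi.single 0 1) = f y) → Module.finrank K (S.comap T) ≤ δ)
    (hu : u + δ ≤ n.multichoose N) :
    ∃ l : Fin u → Fin n → K, ∀ (b : Fin u → K) (c : D),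
      (∀ y, ∑ i, b i * (l i ⬝ᵥ Fin.tail y) ^ N + T c y = 0) → b = 0 ∧ c = 0 := by
  obtain ⟨l, hl⟩ := exists_linearIndependent_pow (K := K) n N
  let v : Fin (n.multichoose N) → (Fin (n + 1) → K) → K := fun k y => (l k ⬝ᵥ Fin.tail y) ^ N
  have hv : LinearIndependent K v := by
    rw [Fintype.linearIndependent_iff] at hl ⊢
    intro b hb
    refine hl b (funext fun y => ?_)
    have := congrFun hb (Fin.cons 0 y)
    simpa [v, Finset.sum_apply] using this
  set W := Submodule.span K (Set.range v) with hW
  have hWfin : FiniteDimensional K W := FiniteDimensional.span_of_finite K (Set.finite_range v)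
  have hWr : Module.finrank K W = n.multichoose N := by
    rw [hW, finrank_span_eq_card hv, Fintype.card_fin]
  have hWinv : ∀ f ∈ W, ∀ y (τ : K), f (y + τ • Pi.single 0 1) = f y := by
    intro f hf
    induction hf using Submodule.span_induction with
    | mem f hf =>
      obtain ⟨k, rfl⟩ := hf
      intro y τ
      have : Fin.tail (y + τ • (Pi.single 0 1 : Fin (n + 1) → K)) = Fin.tail y := by
        funext i; simp [Fin.tail]
      simp [v, this]
    | zero => simp
    | add f g _ _ hf hg => intro y τ; simp [hf y τ, hg y τ]
    | smul r f _ hf => intro y τ; simp [hf y τ]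
  have hdδ := hδ W hWinv
  set R := LinearMap.range T with hR
  have h1 := finrank_le_finrank_inf_ker_add W R.mkQ
  rw [Submodule.ker_mkQ] at h1
  have h2 : Module.finrank K (W ⊓ R : Submodule K _) ≤ δ := by
    rw [inf_comm, hR, ← Submodule.map_comap_eq]
    exact (Submodule.finrank_map_le _ _).trans hdδ
  obtain ⟨κ, a, ha, hsp, hli⟩ := exists_linearIndependent' K (R.mkQ ∘ v)
  have : Finite κ := Finite.of_injective a ha
  have := Fintype.ofFinite κ
  have h3 : u ≤ Fintype.card κ := by
    have h4 := finrank_span_eq_card hli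
    rw [hsp, Set.range_comp, ← Submodule.map_span, ← hW] at h4
    omega
  obtain ⟨σ⟩ : Nonempty (Fin u ↪ κ) := by
    rw [Function.Embedding.nonempty_iff_card_le]; simpa using h3
  refine ⟨fun i => l (a (σ i)), fun b c hbc => ?_⟩
  have hb : b = 0 := by
    have h5 := Fintype.linearIndependent_iff.mp (hli.comp σ σ.injective) b ?_
    · exact funext h5
    · have : ∑ i, b i • v (a (σ i)) = T (-c) := by
        funext y
        have := hbc y
        simp only [Finset.sum_apply, Pi.smul_apply, smul_eq_mul, map_neg, Pi.neg_apply, v]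
        linear_combination this
      simp only [Function.comp, ← map_smul, ← map_sum, this]
      simp [hR]
  refine ⟨hb, hT c (funext fun y => ?_)⟩
  simpa [hb] using hbc y

/-- The differential Horace step. -/
theorem HasDefect.horace {e n u k δ : ℕ} (hu : HasDefect K (e + 2) n u 0)
    (hk : HasDefect K (e + 1) (n + 1) k 0) (hδ : HasDefect K e (n + 1) k δ)
    (h : u + δ ≤ n.multichoose (e + 2)) : HasDefect K (e + 2) (n + 1) (u + k) 0 := by
  obtain ⟨g, ⟨hg1, hg2⟩, hg0⟩ : ∃ g : Fin k → Fin (n + 1) → K,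
      (Module.finrank K (LinearMap.ker (veroneseTangent (e + 1) g)) ≤ 0 ∧
        Module.finrank K (LinearMap.ker (veroneseTangent e g)) ≤ δ) ∧ ∀ j, g j 0 ≠ 0 :=
    ((lineOpen_veroneseTangent _ _).and (lineOpen_veroneseTangent _ _)).exists_and
      (LineOpen.forall fun j => lineOpen_coord_ne_zero j 0)
      ((lineOpen_veroneseTangent _ _).exists_and (lineOpen_veroneseTangent _ _) hk hδ)
      ⟨fun _ _ => 1, by simp⟩
  rw [finrank_ker_le_zero] at hg1
  have hmod := exists_pow_linearIndependent_mod (veroneseTangent (e + 1) g) hg1 (δ := δ)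
    (fun S hS => by
    refine le_trans (finrank_le_of_injOn (T := LinearMap.ker (veroneseTangent e g))
      (polarTwist e g) (fun c _ => polarTwist_injective hg0 c) ?_) hg2
    intro c hc
    have := sum_pow_mul_directional e g c (Pi.single 0 1) fun y τ => hS _ hc y τ
    simpa [polarTwist] using this) h
  let f : (Fin u → Fin n → K) → ((Fin u → K) × (Fin k → Fin (n + 1) → K)) →ₗ[K]
      ((Fin (n + 1) → K) → K) := fun l =>
    { toFun := fun bc y => ∑ i, bc.1 i * (l i ⬝ᵥ Fin.tail y) ^ (e + 2) +
        veroneseTangent (e + 1) g bc.2 y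
      map_add' := fun a b => by
        funext y
        simp only [Prod.fst_add, Prod.snd_add, Pi.add_apply, add_mul, Finset.sum_add_distrib,
          map_add]
        ring
      map_smul' := fun r a => by
        funext y
        simp only [Prod.smul_fst, Prod.smul_snd, Pi.smul_apply, smul_eq_mul, map_smul,
          RingHom.id_apply, mul_add, Finset.mul_sum, mul_assoc] }
  have hopen : LineOpen K fun l => Module.finrank K (LinearMap.ker (f l)) ≤ 0 := by
    refine lineOpen_finrank_ker_le f (fun bc y => ?_) 0
    have : (fun l => f l bc y) = ∑ i, bc.1 i •
        (fun l : Fin u → Fin n → K => l i ⬝ᵥ Fin.tail y) ^ (e + 2) +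
        algebraMap K _ (veroneseTangent (e + 1) g bc.2 y) := by
      funext l
      simp [f, Finset.sum_apply]
    rw [this]
    exact add_mem (sum_mem fun i _ => Subalgebra.smul_mem _
      (pow_mem (dotProduct_mem_linePoly i _) _) _) (Subalgebra.algebraMap_mem _ _)
  obtain ⟨l, hl1, hl2⟩ := hopen.exists_and (lineOpen_veroneseTangent (e + 2) 0) (by
    obtain ⟨l, hl⟩ := hmod
    refine ⟨l, (finrank_ker_le_zero _).mpr fun bc hbc => ?_⟩
    obtain ⟨h1, h2⟩ := hl bc.1 bc.2 fun y => congrFun hbc y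
    exact Prod.ext h1 h2) hu
  rw [finrank_ker_le_zero] at hl1 hl2
  refine hasDefect_of_equiv (J := Fin u ⊕ Fin k) finSumFinEquiv (Equiv.refl _)
    (Sum.elim (fun i => Fin.cons 0 (l i)) g) ((finrank_ker_le_zero _).mpr fun c hc => ?_)
  have h1 := sum_pow_mul_directional (e + 1) _ c (Pi.single 0 1) (fun y τ => by
    rw [hc]; rfl)
  have h2 := hl1 (fun i => c (Sum.inl i) 0, polarTwist (e + 1) g fun j => c (Sum.inr j)) (by
    funext y
    have := congrFun h1 y
    rw [veroneseTangent_apply, Fintype.sum_sum_type] at this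
    simp only [f, LinearMap.coe_mk, AddHom.coe_mk]
    rw [← this]
    congr 1
    · refine Finset.sum_congr rfl fun i _ => ?_
      simp [cons_zero_dotProduct, smul_dotProduct]
      ring
    · rw [veroneseTangent_apply]
      refine Finset.sum_congr rfl fun i _ => ?_
      simp [polarTwist])
  have h3 : ∀ j, c (Sum.inr j) = 0 := fun j =>
    congrFun (polarTwist_injective hg0 _ (congrArg Prod.snd h2)) j
  have h4 : ∀ i, c (Sum.inl i) 0 = 0 := fun i => congrFun (congrArg Prod.fst h2) i
  have h5 := hl2 (fun i => Fin.tail (c (Sum.inl i))) (by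
    funext y
    have := congrFun hc (Fin.cons 0 y)
    rw [veroneseTangent_apply, Fintype.sum_sum_type] at this
    rw [Pi.zero_apply] at this ⊢
    rw [← this, veroneseTangent_apply]
    simp only [Sum.elim_inl, cons_zero_dotProduct, Fin.tail_cons, h3, zero_dotProduct, mul_zero,
      Finset.sum_const_zero, add_zero]
    refine Finset.sum_congr rfl fun i _ => ?_
    congr 1
    simp [dotProduct, Fin.sum_univ_succ, Fin.tail])
  funext j i
  rcases j with j | j
  · refine Fin.cases (h4 j) (fun i => ?_) i
    exact congrFun (congrFun h5 j) i
  · exact congrFun (h3 j) i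

theorem hasDefect_binary : ∀ e q : ℕ, 2 * q ≤ e + 2 → HasDefect K e 2 q 0
  | 0, q, h => (hasDefect_one_point 0 1).mono_card (by omega)
  | 1, q, h => (hasDefect_one_point 1 1).mono_card (by omega)
  | e + 2, q, h => by
    rcases Nat.eq_zero_or_pos q with rfl | hq
    · exact (hasDefect_one_point (e + 2) 1).mono_card (by omega)
    · have := HasDefect.horace (u := 1) (k := q - 1) (δ := 0) (hasDefect_one_point (e + 2) 0)
        (hasDefect_binary (e + 1) (q - 1) (by omega)) (hasDefect_binary e (q - 1) (by omega))
        (by simp [Nat.multichoose_one])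
      rwa [show 1 + (q - 1) = q by omega] at this

end Horace

section Cubics

variable {K : Type*} [Field K]

/-- The coefficient of the cubic `p ^ 2 * c` at a triple of coordinates, up to a constant. -/
def cubicTerm {ι : Type*} (p c : ι → K) (x y z : ι) : K :=
  p x * p y * c z + p x * c y * p z + c x * p y * p z

variable (K) in
/-- There are points `p j` supported in `A j` such that tangent vectors `c j` supported in `B j`
are determined by the coefficients in `T` of the cubic `∑ j, (p j) ^ 2 * c j`. -/
def CubicGood {P ι : Type} [Fintype P] (A B : P → ι → Prop) (T : ι → ι → ι → Prop) : Prop :=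
  ∃ p : P → ι → K, (∀ j i, ¬ A j i → p j i = 0) ∧ ∀ c : P → ι → K, (∀ j i, ¬ B j i → c j i = 0) →
    (∀ x y z, T x y z → ∑ j, cubicTerm (p j) (c j) x y z = 0) → c = 0

theorem CubicGood.map {P P' ι ι' : Type} [Fintype P] [Fintype P'] {A B : P → ι → Prop}
    {T : ι → ι → ι → Prop} {A' B' : P' → ι' → Prop} {T' : ι' → ι' → ι' → Prop}
    (h : CubicGood K A' B' T') (φ : P' ↪ P) (ψ : ι' ↪ ι) (hA : ∀ j i, A' j i → A (φ j) (ψ i))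
    (hB : ∀ j i, B j i → ∃ j' i', φ j' = j ∧ ψ i' = i ∧ B' j' i')
    (hT : ∀ x y z, T' x y z → T (ψ x) (ψ y) (ψ z)) : CubicGood K A B T := by
  obtain ⟨p, hp, h⟩ := h
  set p' : P → ι → K := Function.extend φ (fun j => Function.extend ψ (p j) 0) 0 with hp'
  have hpe : ∀ j i, p' (φ j) (ψ i) = p j i := fun j i => by
    rw [hp', φ.injective.extend_apply, ψ.injective.extend_apply]
  have hpn : ∀ j i, p' j i ≠ 0 → ∃ j' i', φ j' = j ∧ ψ i' = i := by
    intro j i hne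
    by_cases hj : ∃ j', φ j' = j
    · obtain ⟨j', rfl⟩ := hj
      by_cases hi : ∃ i', ψ i' = i
      · obtain ⟨i', rfl⟩ := hi
        exact ⟨j', i', rfl, rfl⟩
      · rw [hp', φ.injective.extend_apply, Function.extend_apply' _ _ _ hi] at hne
        exact absurd rfl hne
    · rw [hp', Function.extend_apply' _ _ _ hj] at hne
      exact absurd rfl hne
  refine ⟨p', fun j i hji => ?_, fun c hc hT' => ?_⟩
  · by_contra hne
    obtain ⟨j', i', rfl, rfl⟩ := hpn j i hne
    rw [hpe] at hne
    exact hne (hp j' i' fun ha => hji (hA _ _ ha))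
  · have hcn : ∀ j i, c j i ≠ 0 → ∃ j' i', φ j' = j ∧ ψ i' = i ∧ B' j' i' := fun j i hne =>
      hB j i (by_contra fun hb => hne (hc j i hb))
    have h0 := h (fun j i => c (φ j) (ψ i)) (fun j i hb => by
      by_contra hne
      obtain ⟨j', i', h1, h2, h3⟩ := hcn _ _ hne
      rw [φ.injective h1, ψ.injective h2] at h3
      exact hb h3) fun x y z hxyz => by
        rw [← hT' _ _ _ (hT x y z hxyz)]
        refine Finset.sum_of_injOn φ φ.injective.injOn (by simp) ?_ ?_
        · intro j _ hj
          have hcj : ∀ i, c j i = 0 := fun i => by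
            by_contra hne
            obtain ⟨j', i', h1, -⟩ := hcn _ _ hne
            exact hj ⟨j', by simp, h1⟩
          simp [cubicTerm, hcj]
        · intro j _
          simp [cubicTerm, hpe]
    funext j i
    by_contra hne
    obtain ⟨j', i', rfl, rfl, -⟩ := hcn j i hne
    exact hne (congrFun (congrFun h0 j') i')

theorem CubicGood.split [Infinite K] {P ι : Type} [Fintype P] [Fintype ι] {A B B₁ B₂ : P → ι → Prop}
    {T T₁ T₂ : ι → ι → ι → Prop} (h₁ : CubicGood K A B₁ T₂) (h₂ : CubicGood K A B₂ T₁)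
    (hB : ∀ j i, B j i → B₁ j i ∨ B₂ j i) (hT₁ : ∀ x y z, T₁ x y z → T x y z)
    (hT₂ : ∀ x y z, T₂ x y z → T x y z)
    (hv : ∀ j x y z, T₁ x y z → ¬ (A j x ∧ A j y ∧ B₁ j z) ∧ ¬ (A j x ∧ B₁ j y ∧ A j z) ∧
      ¬ (B₁ j x ∧ A j y ∧ A j z)) : CubicGood K A B T := by
  classical
  let f : (P → ι → Prop) → (ι → ι → ι → Prop) → (P → ι → K) →
      (P → ι → K) →ₗ[K] ((ι × ι × ι) ⊕ (P × ι) → K) := fun B T p =>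
    { toFun := fun c => Sum.elim
        (fun x => if T x.1 x.2.1 x.2.2 then ∑ j, cubicTerm (p j) (c j) x.1 x.2.1 x.2.2 else 0)
        (fun x => if B x.1 x.2 then 0 else c x.1 x.2)
      map_add' := fun c c' => by
        funext x
        rcases x with x | x
        · simp only [Sum.elim_inl, Pi.add_apply]
          split_ifs
          · rw [← Finset.sum_add_distrib]
            exact Finset.sum_congr rfl fun j _ => by simp only [cubicTerm, Pi.add_apply]; ring
          · simp
        · simp only [Sum.elim_inr, Pi.add_apply]
          split_ifs <;> simp
      map_smul' := fun r c => by
        funext x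
        rcases x with x | x
        · simp only [Sum.elim_inl, Pi.smul_apply, RingHom.id_apply, smul_eq_mul]
          split_ifs
          · rw [Finset.mul_sum]
            exact Finset.sum_congr rfl fun j _ => by
              simp only [cubicTerm, Pi.smul_apply, smul_eq_mul]; ring
          · simp
        · simp only [Sum.elim_inr, Pi.smul_apply, RingHom.id_apply, smul_eq_mul]
          split_ifs <;> simp }
  have hf : ∀ B T p, Module.finrank K (LinearMap.ker (f B T p)) ≤ 0 ↔
      ∀ c : P → ι → K, (∀ j i, ¬ B j i → c j i = 0) →
        (∀ x y z, T x y z → ∑ j, cubicTerm (p j) (c j) x y z = 0) → c = 0 := by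
    intro B T p
    rw [finrank_ker_le_zero]
    refine forall_congr' fun c => ⟨fun h h1 h2 => h ?_, fun h h0 => h ?_ ?_⟩
    · funext x
      rcases x with x | x
      · by_cases hx : T x.1 x.2.1 x.2.2
        · simp [f, hx, h2 _ _ _ hx]
        · simp [f, hx]
      · by_cases hx : B x.1 x.2
        · simp [f, hx]
        · simp [f, hx, h1 _ _ hx]
    · intro j i hji
      simpa [f, hji] using congrFun h0 (Sum.inr (j, i))
    · intro x y z hxyz
      simpa [f, hxyz] using congrFun h0 (Sum.inl (x, y, z))
  have hcoord : ∀ (j : P) (i : ι), (fun p : P → ι → K => p j i) ∈ linePoly K (P → ι → K) :=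
    fun j i => linearMap_mem_linePoly
      { toFun := fun p : P → ι → K => p j i
        map_add' := fun _ _ => rfl
        map_smul' := fun _ _ => rfl }
  have hopen : ∀ B T, LineOpen K fun p => Module.finrank K (LinearMap.ker (f B T p)) ≤ 0 := by
    intro B T
    refine lineOpen_finrank_ker_le (f B T) (fun c x => ?_) 0
    rcases x with x | x
    · by_cases hx : T x.1 x.2.1 x.2.2
      · have : (fun p => f B T p c (Sum.inl x)) = ∑ j,
            (c j x.2.2 • ((fun p : P → ι → K => p j x.1) * fun p : P → ι → K => p j x.2.1) +
            c j x.2.1 • ((fun p : P → ι → K => p j x.1) * fun p : P → ι → K => p j x.2.2) +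
            c j x.1 • ((fun p : P → ι → K => p j x.2.1) * fun p : P → ι → K => p j x.2.2)) := by
          funext p
          simp only [f, LinearMap.coe_mk, AddHom.coe_mk, Sum.elim_inl, hx, if_true,
            Finset.sum_apply, Pi.add_apply, Pi.smul_apply, Pi.mul_apply, smul_eq_mul]
          exact Finset.sum_congr rfl fun j _ => by simp only [cubicTerm]; ring
        rw [this]
        exact sum_mem fun j _ => add_mem (add_mem
          (Subalgebra.smul_mem _ (mul_mem (hcoord _ _) (hcoord _ _)) _)
          (Subalgebra.smul_mem _ (mul_mem (hcoord _ _) (hcoord _ _)) _))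
          (Subalgebra.smul_mem _ (mul_mem (hcoord _ _) (hcoord _ _)) _)
      · have : (fun p => f B T p c (Sum.inl x)) = 0 := by
          funext p; simp [f, hx]
        rw [this]; exact zero_mem _
    · have : (fun p => f B T p c (Sum.inr x)) =
          algebraMap K _ (if B x.1 x.2 then 0 else c x.1 x.2) := by
        funext p; simp [f]
      rw [this]; exact Subalgebra.algebraMap_mem _ _
  let V : Submodule K (P → ι → K) :=
    { carrier := {p | ∀ j i, ¬ A j i → p j i = 0}
      add_mem' := fun {a b} ha hb j i h => by simp [ha j i h, hb j i h]
      zero_mem' := fun _ _ _ => rfl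
      smul_mem' := fun r a ha j i h => by simp [ha j i h] }
  obtain ⟨p, hpV, hp1, hp2⟩ := (hopen B₁ T₂).exists_and_mem (hopen B₂ T₁) V
    (by obtain ⟨p, h, h'⟩ := h₁; exact ⟨p, h, (hf _ _ _).mpr h'⟩)
    (by obtain ⟨p, h, h'⟩ := h₂; exact ⟨p, h, (hf _ _ _).mpr h'⟩)
  rw [hf] at hp1 hp2
  refine ⟨p, hpV, fun c hc hT => ?_⟩
  have hrest := hp2 (fun j i => if B₁ j i then 0 else c j i) (fun j i hji => by
    by_cases h1 : B₁ j i
    · simp [h1]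
    · simp only [h1, if_false]
      exact hc j i fun hb => (hB j i hb).elim h1 hji) (fun x y z hxyz => by
    rw [← hT x y z (hT₁ _ _ _ hxyz)]
    refine Finset.sum_congr rfl fun j _ => ?_
    obtain ⟨v1, v2, v3⟩ := hv j x y z hxyz
    have hA : ∀ i, ¬ A j i → p j i = 0 := hpV j
    simp only [cubicTerm]
    congr 1
    · congr 1
      · by_cases h3 : B₁ j z
        · by_cases h1 : A j x
          · rw [hA y fun h2 => v1 ⟨h1, h2, h3⟩]; ring
          · rw [hA x h1]; ring
        · simp [h3]
      · by_cases h3 : B₁ j y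
        · by_cases h1 : A j x
          · rw [hA z fun h2 => v2 ⟨h1, h3, h2⟩]; ring
          · rw [hA x h1]; ring
        · simp [h3]
    · by_cases h3 : B₁ j x
      · by_cases h1 : A j y
        · rw [hA z fun h2 => v3 ⟨h3, h1, h2⟩]; ring
        · rw [hA y h1]; ring
      · simp [h3])
  refine hp1 c (fun j i hji => ?_) fun x y z hxyz => hT x y z (hT₂ _ _ _ hxyz)
  simpa [hji] using congrFun (congrFun hrest j) i

theorem CubicGood.hasDefect [CharZero K] {n q : ℕ}
    (h : CubicGood K (P := Fin q) (ι := Fin n) (fun _ _ => True) (fun _ _ => True)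
      fun _ _ _ => True) : HasDefect K 2 n q 0 := by
  obtain ⟨p, -, h⟩ := h
  refine ⟨p, (finrank_ker_le_zero _).mpr fun c hc => h c (by simp) fun x y z _ => ?_⟩
  have key : ∀ v, ∑ j, (p j ⬝ᵥ v) ^ 2 * (c j ⬝ᵥ v) = 0 := fun v => congrFun hc v
  let X : Fin n → K := Pi.single x 1
  let Y : Fin n → K := Pi.single y 1
  let Z : Fin n → K := Pi.single z 1
  have h1 : 2 * ∑ j, cubicTerm (p j) (c j) x y z =
      ∑ j, (p j ⬝ᵥ (X + Y + Z)) ^ 2 * (c j ⬝ᵥ (X + Y + Z)) -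
      ∑ j, (p j ⬝ᵥ (X + Y)) ^ 2 * (c j ⬝ᵥ (X + Y)) - ∑ j, (p j ⬝ᵥ (X + Z)) ^ 2 * (c j ⬝ᵥ (X + Z)) -
      ∑ j, (p j ⬝ᵥ (Y + Z)) ^ 2 * (c j ⬝ᵥ (Y + Z)) + ∑ j, (p j ⬝ᵥ X) ^ 2 * (c j ⬝ᵥ X) +
      ∑ j, (p j ⬝ᵥ Y) ^ 2 * (c j ⬝ᵥ Y) + ∑ j, (p j ⬝ᵥ Z) ^ 2 * (c j ⬝ᵥ Z) := by
    simp only [Finset.mul_sum, ← Finset.sum_sub_distrib, ← Finset.sum_add_distrib]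
    refine Finset.sum_congr rfl fun j _ => ?_
    simp only [X, Y, Z, dotProduct_add, dotProduct_single_one, cubicTerm]
    ring
  simp only [key, sub_zero, add_zero] at h1
  exact (mul_eq_zero.mp h1).resolve_left two_ne_zero

end Cubics

section CubicPatterns

variable {K : Type} [Field K] [CharZero K]

/-- Supports of the points in the lines-in-two-blocks pattern. -/
def blockPoint {κ L G : Type} : L ⊕ G ⊕ Fin 3 → κ ⊕ Fin 3 ⊕ Fin 3 → Prop
  | .inl _, .inr (.inr _) => False
  | .inr (.inl _), .inr (.inl _) => False
  | _, _ => True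

/-- Supports of the tangent vectors in the lines-in-two-blocks pattern. -/
def blockTangent {κ L G : Type} : L ⊕ G ⊕ Fin 3 → κ ⊕ Fin 3 ⊕ Fin 3 → Prop
  | .inl _, .inr (.inr _) => True
  | .inr (.inl _), .inr (.inl _) => True
  | .inr (.inr _), _ => True
  | _, _ => False

/-- Coefficients involving both blocks. -/
def blockTest {κ : Type} : κ ⊕ Fin 3 ⊕ Fin 3 → κ ⊕ Fin 3 ⊕ Fin 3 → κ ⊕ Fin 3 ⊕ Fin 3 → Prop
  | _, .inr (.inl _), .inr (.inr _) => True
  | _, _, _ => False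

variable (K) in
/-- Unisolvence of the two-block pattern. -/
def BlockGood (κ L G : Type) [Fintype L] [Fintype G] : Prop :=
  CubicGood K (blockPoint (κ := κ) (L := L) (G := G)) blockTangent blockTest

/-- Supports of the points in the two-block transition pattern. -/
def stepPoint : Fin 2 ⊕ Fin 2 ⊕ Fin 3 → Fin 2 ⊕ Fin 3 ⊕ Fin 3 → Prop
  | .inl _, .inr (.inr _) => False
  | .inr (.inl _), .inr (.inl _) => False
  | .inr (.inr _), .inl _ => False
  | _, _ => True

/-- Supports of the tangent vectors in the two-block transition pattern. -/
def stepTangent : Fin 2 ⊕ Fin 2 ⊕ Fin 3 → Fin 2 ⊕ Fin 3 ⊕ Fin 3 → Prop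
  | .inl _, .inr (.inr _) => True
  | .inr (.inl _), .inr (.inl _) => True
  | .inr (.inr _), .inl _ => True
  | _, _ => False

/-- Coefficients of the two-block transition pattern. -/
def stepTest : Fin 2 ⊕ Fin 3 ⊕ Fin 3 → Fin 2 ⊕ Fin 3 ⊕ Fin 3 → Fin 2 ⊕ Fin 3 ⊕ Fin 3 → Prop
  | .inl _, .inr (.inl _), .inr (.inr _) => True
  | _, _, _ => False

/-- Supports of the points in the one-block pattern. -/
def flagPoint {κ J G : Type} : J ⊕ G → κ ⊕ Fin 3 → Prop
  | .inl _, .inr _ => False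
  | _, _ => True

/-- Supports of the tangent vectors in the one-block pattern. -/
def flagTangent {κ J G : Type} : J ⊕ G → κ ⊕ Fin 3 → Prop
  | .inl _, .inl _ => False
  | _, _ => True

/-- Coefficients involving the block. -/
def flagTest {κ : Type} : κ ⊕ Fin 3 → κ ⊕ Fin 3 → κ ⊕ Fin 3 → Prop
  | _, _, .inr _ => True
  | _, _, _ => False

variable (K) in
/-- Unisolvence of the one-block pattern. -/
def FlagGood (κ J G : Type) [Fintype J] [Fintype G] : Prop :=
  CubicGood K (flagPoint (κ := κ) (J := J) (G := G)) flagTangent flagTest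

variable (K) in
/-- Unisolvence for all cubics. -/
def FullGood (κ J : Type) [Fintype J] : Prop :=
  CubicGood K (P := J) (ι := κ) (fun _ _ => True) (fun _ _ => True) fun _ _ _ => True

omit [CharZero K] in
theorem BlockGood.congr {κ L G κ' L' G' : Type} [Fintype L] [Fintype G] [Fintype L'] [Fintype G']
    (h : BlockGood K κ L G) (e₁ : κ ≃ κ') (e₂ : L ≃ L') (e₃ : G ≃ G') : BlockGood K κ' L' G' := by
  refine CubicGood.map h (Equiv.sumCongr e₂ (Equiv.sumCongr e₃ (Equiv.refl _))).toEmbedding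
    (Equiv.sumCongr e₁ (Equiv.refl _)).toEmbedding ?_ ?_ ?_
  · rintro (j | j | j) (i | i | i) <;> exact id
  · intro j i hji
    refine ⟨(Equiv.sumCongr e₂ (Equiv.sumCongr e₃ (Equiv.refl _))).symm j,
      (Equiv.sumCongr e₁ (Equiv.refl _)).symm i, Equiv.apply_symm_apply _ _,
      Equiv.apply_symm_apply _ _, ?_⟩
    rcases j with j | j | j <;> rcases i with i | i | i <;> exact hji
  · rintro (x | x | x) (y | y | y) (z | z | z) <;> exact id

omit [CharZero K] in
theorem FlagGood.congr {κ J G κ' J' G' : Type} [Fintype J] [Fintype G] [Fintype J'] [Fintype G']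
    (h : FlagGood K κ J G) (e₁ : κ ≃ κ') (e₂ : J ≃ J') (e₃ : G ≃ G') : FlagGood K κ' J' G' := by
  refine CubicGood.map h (Equiv.sumCongr e₂ e₃).toEmbedding
    (Equiv.sumCongr e₁ (Equiv.refl _)).toEmbedding ?_ ?_ ?_
  · rintro (j | j) (i | i) <;> exact id
  · intro j i hji
    refine ⟨(Equiv.sumCongr e₂ e₃).symm j,
      (Equiv.sumCongr e₁ (Equiv.refl _)).symm i, Equiv.apply_symm_apply _ _,
      Equiv.apply_symm_apply _ _, ?_⟩
    rcases j with j | j <;> rcases i with i | i <;> exact hji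
  · rintro (x | x) (y | y) (z | z) <;> exact id

omit [CharZero K] in
theorem FullGood.congr {κ J κ' J' : Type} [Fintype J] [Fintype J']
    (h : FullGood K κ J) (e₁ : κ ≃ κ') (e₂ : J ≃ J') : FullGood K κ' J' :=
  CubicGood.map h e₂.toEmbedding e₁.toEmbedding (fun _ _ => id)
    (fun j i _ => ⟨e₂.symm j, e₁.symm i, e₂.apply_symm_apply j,
      e₁.apply_symm_apply i, trivial⟩) fun _ _ _ => id

theorem BlockGood.step {κ L G : Type} [Fintype κ] [Fintype L] [Fintype G]
    (hC : CubicGood K stepPoint stepTangent stepTest) (h : BlockGood K κ L G) :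
    BlockGood K (κ ⊕ Fin 2) (L ⊕ Fin 2) (G ⊕ Fin 2) := by
  let A : (L ⊕ Fin 2) ⊕ (G ⊕ Fin 2) ⊕ Fin 3 → (κ ⊕ Fin 2) ⊕ Fin 3 ⊕ Fin 3 → Prop
    | .inl (.inl _), .inr (.inr _) => False
    | .inl (.inl _), .inl (.inr _) => False
    | .inl (.inr _), .inr (.inr _) => False
    | .inr (.inl (.inl _)), .inr (.inl _) => False
    | .inr (.inl (.inl _)), .inl (.inr _) => False
    | .inr (.inl (.inr _)), .inr (.inl _) => False
    | .inr (.inr _), .inl (.inr _) => False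
    | _, _ => True
  let B₁ : (L ⊕ Fin 2) ⊕ (G ⊕ Fin 2) ⊕ Fin 3 → (κ ⊕ Fin 2) ⊕ Fin 3 ⊕ Fin 3 → Prop
    | .inl (.inl _), .inr (.inr _) => True
    | .inr (.inl (.inl _)), .inr (.inl _) => True
    | .inr (.inr _), .inl (.inl _) => True
    | .inr (.inr _), .inr _ => True
    | _, _ => False
  let B₂ : (L ⊕ Fin 2) ⊕ (G ⊕ Fin 2) ⊕ Fin 3 → (κ ⊕ Fin 2) ⊕ Fin 3 ⊕ Fin 3 → Prop
    | .inl (.inr _), .inr (.inr _) => True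
    | .inr (.inl (.inr _)), .inr (.inl _) => True
    | .inr (.inr _), .inl (.inr _) => True
    | _, _ => False
  let T₁ : (κ ⊕ Fin 2) ⊕ Fin 3 ⊕ Fin 3 → (κ ⊕ Fin 2) ⊕ Fin 3 ⊕ Fin 3 →
      (κ ⊕ Fin 2) ⊕ Fin 3 ⊕ Fin 3 → Prop
    | .inl (.inr _), .inr (.inl _), .inr (.inr _) => True
    | _, _, _ => False
  have h₁ : CubicGood K A B₁ blockTest := by
    refine CubicGood.map h ((Function.Embedding.inl).sumMap
      ((Function.Embedding.inl).sumMap (Function.Embedding.refl _)))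
      ((Function.Embedding.inl).sumMap (Function.Embedding.refl _)) ?_ ?_ ?_
    · rintro (j | j | j) (i | i | i) <;> exact id
    · rintro ((j | j) | (j | j) | j) ((i | i) | i | i) hji <;> first
        | exact hji.elim
        | exact ⟨.inl j, .inr (.inr i), rfl, rfl, trivial⟩
        | exact ⟨.inr (.inl j), .inr (.inl i), rfl, rfl, trivial⟩
        | exact ⟨.inr (.inr j), .inl i, rfl, rfl, trivial⟩
        | exact ⟨.inr (.inr j), .inr (.inl i), rfl, rfl, trivial⟩
        | exact ⟨.inr (.inr j), .inr (.inr i), rfl, rfl, trivial⟩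
    · rintro (x | x | x) (y | y | y) (z | z | z) <;> exact id
  have h₂ : CubicGood K A B₂ T₁ := by
    refine CubicGood.map hC ((Function.Embedding.inr).sumMap
      ((Function.Embedding.inr).sumMap (Function.Embedding.refl _)))
      ((Function.Embedding.inr).sumMap (Function.Embedding.refl _)) ?_ ?_ ?_
    · rintro (j | j | j) (i | i | i) <;> exact id
    · rintro ((j | j) | (j | j) | j) ((i | i) | i | i) hji <;> first
        | exact hji.elim
        | exact ⟨.inl j, .inr (.inr i), rfl, rfl, trivial⟩
        | exact ⟨.inr (.inl j), .inr (.inl i), rfl, rfl, trivial⟩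
        | exact ⟨.inr (.inr j), .inl i, rfl, rfl, trivial⟩
    · rintro (x | x | x) (y | y | y) (z | z | z) <;> exact id
  refine CubicGood.map (CubicGood.split (B := blockTangent) (T := blockTest) h₁ h₂ ?_ ?_ ?_ ?_)
    (Function.Embedding.refl _) (Function.Embedding.refl _) ?_ (fun j i h => ⟨j, i, rfl, rfl, h⟩)
    fun _ _ _ h => h
  · rintro ((j | j) | (j | j) | j) ((i | i) | i | i) h <;>
      first | exact False.elim h | exact Or.inl trivial | exact Or.inr trivial
  · rintro ((x | x) | x | x) ((y | y) | y | y) ((z | z) | z | z) h <;>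
      first | exact False.elim h | exact trivial
  · exact fun _ _ _ h => h
  · intro j
    rintro ((x | x) | x | x) ((y | y) | y | y) ((z | z) | z | z) h <;> first
      | exact False.elim h
      | rcases j with (j | j) | (j | j) | j <;>
          exact ⟨fun v => by first | exact v.1 | exact v.2.1 | exact v.2.2,
            fun v => by first | exact v.1 | exact v.2.1,
            fun v => v.1⟩
  · rintro ((j | j) | (j | j) | j) ((i | i) | i | i) h <;>
      first | exact False.elim h | exact trivial

theorem FlagGood.step {κ J L G : Type} [Fintype κ] [Fintype J] [Fintype L] [Fintype G]
    (hB : BlockGood K κ L G) (h : FlagGood K κ J G) :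
    FlagGood K (κ ⊕ Fin 3) (J ⊕ L) (G ⊕ Fin 3) := by
  let A : (J ⊕ L) ⊕ (G ⊕ Fin 3) → (κ ⊕ Fin 3) ⊕ Fin 3 → Prop
    | .inl (.inl _), .inl (.inl _) => True
    | .inl (.inr _), .inl _ => True
    | .inr (.inl _), .inl (.inl _) => True
    | .inr (.inl _), .inr _ => True
    | .inr (.inr _), _ => True
    | _, _ => False
  let B₁ : (J ⊕ L) ⊕ (G ⊕ Fin 3) → (κ ⊕ Fin 3) ⊕ Fin 3 → Prop
    | .inl (.inl _), .inr _ => True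
    | .inr (.inl _), .inl (.inl _) => True
    | .inr (.inl _), .inr _ => True
    | _, _ => False
  let B₂ : (J ⊕ L) ⊕ (G ⊕ Fin 3) → (κ ⊕ Fin 3) ⊕ Fin 3 → Prop
    | .inl (.inr _), .inr _ => True
    | .inr (.inl _), .inl (.inr _) => True
    | .inr (.inr _), _ => True
    | _, _ => False
  let T₁ : (κ ⊕ Fin 3) ⊕ Fin 3 → (κ ⊕ Fin 3) ⊕ Fin 3 → (κ ⊕ Fin 3) ⊕ Fin 3 → Prop
    | _, .inl (.inr _), .inr _ => True
    | _, _, _ => False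
  have h₁ : CubicGood K A B₁ flagTest := by
    refine CubicGood.map h ((Function.Embedding.inl).sumMap Function.Embedding.inl)
      ((Function.Embedding.inl).sumMap (Function.Embedding.refl _)) ?_ ?_ ?_
    · rintro (j | j) (i | i) <;> exact id
    · rintro ((j | j) | (j | j)) ((i | i) | i) hji <;> first
        | exact hji.elim
        | exact ⟨.inl j, .inr i, rfl, rfl, trivial⟩
        | exact ⟨.inr j, .inl i, rfl, rfl, trivial⟩
        | exact ⟨.inr j, .inr i, rfl, rfl, trivial⟩
    · rintro (x | x) (y | y) (z | z) <;> exact id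
  have h₂ : CubicGood K A B₂ T₁ := by
    let φ : L ⊕ G ⊕ Fin 3 ↪ (J ⊕ L) ⊕ (G ⊕ Fin 3) :=
      (Function.Embedding.inr).sumMap (Function.Embedding.refl _)
    refine CubicGood.map hB φ (Equiv.sumAssoc κ (Fin 3) (Fin 3)).symm.toEmbedding ?_ ?_ ?_
    · rintro (j | j | j) (i | i | i) <;> exact id
    · rintro ((j | j) | (j | j)) ((i | i) | i) hji <;> first
        | exact hji.elim
        | exact ⟨.inl j, .inr (.inr i), rfl, rfl, trivial⟩
        | exact ⟨.inr (.inl j), .inr (.inl i), rfl, rfl, trivial⟩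
        | exact ⟨.inr (.inr j), .inl i, rfl, rfl, trivial⟩
        | exact ⟨.inr (.inr j), .inr (.inl i), rfl, rfl, trivial⟩
        | exact ⟨.inr (.inr j), .inr (.inr i), rfl, rfl, trivial⟩
    · rintro (x | x | x) (y | y | y) (z | z | z) <;> exact id
  refine CubicGood.map (CubicGood.split (B := flagTangent) (T := flagTest) h₁ h₂ ?_ ?_ ?_ ?_)
    (Function.Embedding.refl _) (Function.Embedding.refl _) ?_ (fun j i h => ⟨j, i, rfl, rfl, h⟩)
    fun _ _ _ h => h
  · rintro ((j | j) | (j | j)) ((i | i) | i) h <;>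
      first | exact False.elim h | exact Or.inl trivial | exact Or.inr trivial
  · rintro ((x | x) | x) ((y | y) | y) ((z | z) | z) h <;>
      first | exact False.elim h | exact trivial
  · exact fun _ _ _ h => h
  · intro j
    rintro ((x | x) | x) ((y | y) | y) ((z | z) | z) h <;> first
      | exact False.elim h
      | rcases j with (j | j) | (j | j) <;>
          exact ⟨fun v => by first | exact v.1 | exact v.2.1 | exact v.2.2,
            fun v => by first | exact v.1 | exact v.2.1,
            fun v => by first | exact v.1 | exact v.2.1⟩
  · rintro ((j | j) | (j | j)) ((i | i) | i) h <;>
      first | exact False.elim h | exact trivial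

theorem FullGood.step {κ J G : Type} [Fintype κ] [Fintype J] [Fintype G]
    (hA : FlagGood K κ J G) (h : FullGood K κ J) : FullGood K (κ ⊕ Fin 3) (J ⊕ G) := by
  let B₁ : J ⊕ G → κ ⊕ Fin 3 → Prop
    | .inl _, .inl _ => True
    | _, _ => False
  let T₂ : κ ⊕ Fin 3 → κ ⊕ Fin 3 → κ ⊕ Fin 3 → Prop
    | .inl _, .inl _, .inl _ => True
    | _, _, _ => False
  have h₁ : CubicGood K (flagPoint (κ := κ) (J := J) (G := G)) B₁ T₂ := by
    refine CubicGood.map h Function.Embedding.inl Function.Embedding.inl ?_ ?_ ?_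
    · exact fun _ _ => id
    · rintro (j | j) (i | i) hji <;> first
        | exact hji.elim
        | exact ⟨j, i, rfl, rfl, trivial⟩
    · exact fun _ _ _ => id
  refine CubicGood.map (CubicGood.split (B := fun _ _ => True) (T := fun _ _ _ => True) h₁ hA
    ?_ ?_ ?_ ?_)
    (Function.Embedding.refl _) (Function.Embedding.refl _) (fun _ _ _ => trivial)
    (fun j i h => ⟨j, i, rfl, rfl, h⟩) fun _ _ _ h => h
  · rintro (j | j) (i | i) h <;>
      first | exact False.elim h | exact Or.inl trivial | exact Or.inr trivial
  · exact fun _ _ _ _ => trivial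
  · exact fun _ _ _ _ => trivial
  · intro j
    rintro (x | x) (y | y) (z | z) h <;> first
      | exact False.elim h
      | rcases j with j | j <;>
          exact ⟨fun v => by first | exact v.1 | exact v.2.1 | exact v.2.2,
            fun v => by first | exact v.1 | exact v.2.1 | exact v.2.2,
            fun v => by first | exact v.1 | exact v.2.1 | exact v.2.2⟩

end CubicPatterns

section CubicBases

variable {K : Type} [Field K] [CharZero K]

theorem cubicGood_step : CubicGood K stepPoint stepTangent stepTest := by
  refine ⟨Sum.elim (fun j => Sum.elim (!![1, 0; 0, 1] j) (Sum.elim (!![1, 0, 0; 0, 1, 0] j) 0))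
    (Sum.elim (fun j => Sum.elim (!![1, -1; -1, -1] j) (Sum.elim 0 (!![0, 0, 1; 0, 1, 0] j)))
    (fun j => Sum.elim 0 (Sum.elim (!![0, 0, -1; 0, 1, -1; -1, -1, 0] j)
      (!![-1, -1, 0; 1, 0, 1; 1, -1, -1] j)))), ?_, ?_⟩
  · rintro (j | j | j) (i | i | i) h <;> first
      | rfl
      | exact absurd trivial h
  · intro c hc hT
    have h := fun (y : Fin 2) (z w : Fin 3) => hT (.inl y) (.inr (.inl z)) (.inr (.inr w)) trivial
    have e1 := fun j i => hc (.inl j) (.inl i) id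
    have e2 := fun j i => hc (.inl j) (.inr (.inl i)) id
    have e3 := fun j i => hc (.inr (.inl j)) (.inl i) id
    have e4 := fun j i => hc (.inr (.inl j)) (.inr (.inr i)) id
    have e5 := fun j i => hc (.inr (.inr j)) (.inr i) id
    clear hc hT
    simp [Fin.forall_fin_succ, Fin.sum_univ_succ, cubicTerm, e1, e2, e3, e4, e5,
      -Fin.isValue] at h
    have key : (∀ i w, c (.inl i) (.inr (.inr w)) = 0) ∧
        (∀ i w, c (.inr (.inl i)) (.inr (.inl w)) = 0) ∧
        ∀ i w, c (.inr (.inr i)) (.inl w) = 0 := by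
      clear e1 e2 e3 e4 e5
      simp [Fin.forall_fin_succ, -Fin.isValue]
      grind (splits := 100)
    funext j i
    rcases j with j | j | j <;> rcases i with i | i | i <;> first
      | exact e1 j i
      | exact e2 j i
      | exact e3 j i
      | exact e4 j i
      | exact e5 j _
      | exact key.1 j i
      | exact key.2.1 j i
      | exact key.2.2 j i

theorem blockGood_zero : BlockGood K (Fin 0) (Fin 3) (Fin 3) := by
  refine ⟨Sum.elim (fun j => Sum.elim 0 (Sum.elim (!![1, 0, 0; 0, 1, 0; 0, 0, 1] j) 0))
    (Sum.elim (fun j => Sum.elim 0 (Sum.elim 0 (!![1, 0, 0; 0, 1, 0; 0, 0, 1] j)))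
    (fun j => Sum.elim 0 (Sum.elim (!![0, 1, 1; 1, 1, 1; -1, 0, -1] j)
      (!![0, -1, 1; -1, 1, -1; -1, 0, 1] j)))), ?_, ?_⟩
  · rintro (j | j | j) (i | i | i) h <;> first
      | rfl
      | exact absurd trivial h
  · intro c hc hT
    have h := fun (y z w : Fin 3) => hT (.inr (.inl y)) (.inr (.inl z)) (.inr (.inr w)) trivial
    have h' := fun (y z w : Fin 3) => hT (.inr (.inr y)) (.inr (.inl z)) (.inr (.inr w)) trivial
    have e1 := fun j i => hc (.inl j) (.inr (.inl i)) id
    have e2 := fun j i => hc (.inr (.inl j)) (.inr (.inr i)) id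
    clear hc hT
    simp [Fin.forall_fin_succ, Fin.sum_univ_succ, cubicTerm, e1, e2, -Fin.isValue] at h h'
    have key : (∀ i w, c (.inl i) (.inr (.inr w)) = 0) ∧
        (∀ i w, c (.inr (.inl i)) (.inr (.inl w)) = 0) ∧
        (∀ i w, c (.inr (.inr i)) (.inr (.inl w)) = 0) ∧
        ∀ i w, c (.inr (.inr i)) (.inr (.inr w)) = 0 := by
      clear e1 e2
      simp [Fin.forall_fin_succ, -Fin.isValue]
      grind (splits := 100)
    funext j i
    rcases i with i | i | i
    · exact i.elim0
    all_goals rcases j with j | j | j <;> first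
      | exact e1 j i
      | exact e2 j i
      | exact key.1 j i
      | exact key.2.1 j i
      | exact key.2.2.1 j i
      | exact key.2.2.2 j i

theorem blockGood_one : BlockGood K (Fin 1) (Fin 4) (Fin 4) := by
  refine ⟨Sum.elim (fun j => Sum.elim (!![0; 0; 0; 1] j)
      (Sum.elim (!![1, 0, 0; 0, 1, 0; 0, 0, 1; 0, 1, 1] j) 0))
    (Sum.elim (fun j => Sum.elim (!![0; 0; 0; 1] j)
      (Sum.elim 0 (!![1, 0, 0; 0, 1, 0; 0, 0, 1; 0, 1, 0] j)))
    (fun j => Sum.elim (!![0; 0; 1] j) (Sum.elim (!![2, 2, 2; 0, 1, 2; 1, 0, 2] j)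
      (!![2, 2, 0; 1, 1, 1; 2, 1, 1] j)))), ?_, ?_⟩
  · rintro (j | j | j) (i | i | i) h <;> first
      | rfl
      | exact absurd trivial h
  · intro c hc hT
    have h := fun (y z w : Fin 3) => hT (.inr (.inl y)) (.inr (.inl z)) (.inr (.inr w)) trivial
    have h' := fun (y z w : Fin 3) => hT (.inr (.inr y)) (.inr (.inl z)) (.inr (.inr w)) trivial
    have h'' := fun (z w : Fin 3) => hT (.inl 0) (.inr (.inl z)) (.inr (.inr w)) trivial
    have e1 := fun j i => hc (.inl j) (.inr (.inl i)) id
    have e2 := fun j i => hc (.inr (.inl j)) (.inr (.inr i)) id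
    have e3 := fun j i => hc (.inl j) (.inl i) id
    have e4 := fun j i => hc (.inr (.inl j)) (.inl i) id
    clear hc hT
    simp [Fin.forall_fin_succ, Fin.sum_univ_succ, cubicTerm, e1, e2, e3, e4, -Fin.isValue]
      at h h' h''
    have key : (∀ i w, c (.inl i) (.inr (.inr w)) = 0) ∧
        (∀ i w, c (.inr (.inl i)) (.inr (.inl w)) = 0) ∧
        (∀ i w, c (.inr (.inr i)) (.inr (.inl w)) = 0) ∧
        (∀ i w, c (.inr (.inr i)) (.inr (.inr w)) = 0) ∧
        ∀ i, c (.inr (.inr i)) (.inl 0) = 0 := by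
      clear e1 e2 e3 e4
      simp [Fin.forall_fin_succ, -Fin.isValue]
      grind (splits := 100)
    funext j i
    rcases i with i | i | i
    · rw [Subsingleton.elim i 0]
      rcases j with j | j | j
      · exact e3 j 0
      · exact e4 j 0
      · exact key.2.2.2.2 j
    all_goals rcases j with j | j | j <;> first
      | exact e1 j i
      | exact e2 j i
      | exact key.1 j i
      | exact key.2.1 j i
      | exact key.2.2.1 j i
      | exact key.2.2.2.1 j i

end CubicBases

section CubicSequences

variable {K : Type} [Field K] [CharZero K]

theorem flagGood_zero : FlagGood K (Fin 0) (Fin 0) (Fin 3) := by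
  refine ⟨Sum.elim (fun j => j.elim0) (fun j => Sum.elim 0 (!![1, 0, 0; 0, 1, 0; 0, 0, 1] j)),
    ?_, ?_⟩
  · rintro (j | j) (i | i) h <;> first
      | exact j.elim0
      | exact i.elim0
      | exact absurd trivial h
  · intro c hc hT
    have h := fun (y z w : Fin 3) => hT (.inr y) (.inr z) (.inr w) trivial
    clear hc hT
    simp [Fin.forall_fin_succ, Fin.sum_univ_succ, cubicTerm, -Fin.isValue] at h
    have key : ∀ i w, c (.inr i) (.inr w) = 0 := by
      simp [Fin.forall_fin_succ, -Fin.isValue]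
      grind (splits := 100)
    funext j i
    rcases j with j | j <;> rcases i with i | i <;> first
      | exact j.elim0
      | exact i.elim0
      | exact key j i

theorem flagGood_one : FlagGood K (Fin 1) (Fin 0) (Fin 4) := by
  refine ⟨Sum.elim (fun j => j.elim0) (fun j => Sum.elim (!![0; 0; 0; 1] j)
    (!![1, 0, 0; 0, 1, 0; 0, 0, 1; 1, 1, 1] j)), ?_, ?_⟩
  · rintro (j | j) (i | i) h <;> first
      | exact j.elim0
      | exact absurd trivial h
  · intro c hc hT
    have h := fun (y z w : Fin 3) => hT (.inr y) (.inr z) (.inr w) trivial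
    have h' := fun (z w : Fin 3) => hT (.inl 0) (.inr z) (.inr w) trivial
    have h'' := fun (w : Fin 3) => hT (.inl 0) (.inl 0) (.inr w) trivial
    clear hc hT
    simp [Fin.forall_fin_succ, Fin.sum_univ_succ, cubicTerm, -Fin.isValue] at h h' h''
    have key : (∀ i w, c (.inr i) (.inr w) = 0) ∧ ∀ i, c (.inr i) (.inl 0) = 0 := by
      simp [Fin.forall_fin_succ, -Fin.isValue]
      grind (splits := 100)
    funext j i
    rcases j with j | j <;> rcases i with i | i <;> first
      | exact j.elim0
      | (rw [Subsingleton.elim i 0]; exact key.2 j)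
      | exact key.1 j i

theorem flagGood_two : FlagGood K (Fin 2) (Fin 1) (Fin 5) := by
  refine ⟨Sum.elim (fun j => Sum.elim (!![1, 0] j) 0)
    (fun j => Sum.elim (!![0, 0; 0, 0; 0, 0; 1, 0; 0, 1] j)
    (!![1, 0, 0; 0, 1, 0; 0, 0, 1; -1, -1, 1; 0, 1, -1] j)), ?_, ?_⟩
  · rintro (j | j) (i | i) h <;> first
      | rfl
      | exact absurd trivial h
  · intro c hc hT
    have h := fun (y z w : Fin 3) => hT (.inr y) (.inr z) (.inr w) trivial
    have h' := fun (y : Fin 2) (z w : Fin 3) => hT (.inl y) (.inr z) (.inr w) trivial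
    have h'' := fun (y z : Fin 2) (w : Fin 3) => hT (.inl y) (.inl z) (.inr w) trivial
    have e1 := fun j i => hc (.inl j) (.inl i) id
    clear hc hT
    simp [Fin.forall_fin_succ, Fin.sum_univ_succ, cubicTerm, e1, -Fin.isValue] at h h' h''
    have key : (∀ i w, c (.inr i) (.inr w) = 0) ∧ (∀ i w, c (.inr i) (.inl w) = 0) ∧
        ∀ i w, c (.inl i) (.inr w) = 0 := by
      clear e1
      simp [Fin.forall_fin_succ, -Fin.isValue]
      grind (splits := 100)
    funext j i
    rcases j with j | j <;> rcases i with i | i <;> first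
      | exact e1 j i
      | exact key.1 j i
      | exact key.2.1 j i
      | exact key.2.2 j i

omit [CharZero K] in
theorem fullGood_of_isEmpty {κ : Type} [Fintype κ] : FullGood K κ (Fin 0) :=
  ⟨fun j => j.elim0, fun j => j.elim0, fun _ _ _ => funext fun j => j.elim0⟩

theorem fullGood_two : FullGood K (Fin 2) (Fin 1) := by
  refine ⟨fun _ => ![1, 0], fun _ _ h => absurd trivial h, fun c _ hT => ?_⟩
  have h0 := hT 0 0 0 trivial
  have h1 := hT 0 0 1 trivial
  simp [cubicTerm] at h0 h1
  funext j i
  rw [Subsingleton.elim j 0]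
  fin_cases i
  · simp; grind
  · simp; grind

/-- The number of points in dimension `n` for which cubics are treated. -/
def cubicCount : ℕ → ℕ
  | 0 => 0
  | 1 => 0
  | 2 => 1
  | n + 3 => cubicCount n + (n + 3)

variable (K) in
theorem blockGood_fin : ∀ k, BlockGood K (Fin k) (Fin (k + 3)) (Fin (k + 3))
  | 0 => blockGood_zero
  | 1 => blockGood_one
  | k + 2 => ((blockGood_fin k).step cubicGood_step).congr finSumFinEquiv finSumFinEquiv
      finSumFinEquiv

variable (K) in
theorem flagGood_fin : ∀ k, FlagGood K (Fin k) (Fin (cubicCount k)) (Fin (k + 3))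
  | 0 => flagGood_zero
  | 1 => flagGood_one
  | 2 => flagGood_two
  | k + 3 =>
    (FlagGood.step (blockGood_fin K k) (flagGood_fin k)).congr finSumFinEquiv finSumFinEquiv
      finSumFinEquiv

variable (K) in
theorem fullGood_fin : ∀ k, FullGood K (Fin k) (Fin (cubicCount k))
  | 0 => fullGood_of_isEmpty
  | 1 => fullGood_of_isEmpty
  | 2 => fullGood_two
  | k + 3 => (FullGood.step (flagGood_fin K k) (fullGood_fin k)).congr finSumFinEquiv finSumFinEquiv

theorem le_cubicCount : ∀ n, (n + 3) * (n + 5) ≤ 6 * cubicCount (n + 3)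
  | 0 => by simp [cubicCount]
  | 1 => by simp [cubicCount]
  | 2 => by simp [cubicCount]
  | n + 3 => by
    have := le_cubicCount n
    rw [cubicCount]
    nlinarith

theorem hasDefect_cubic {n q : ℕ} (hn : 3 ≤ n) (h : 6 * q ≤ n * (n + 2) + 5) :
    HasDefect K 2 n q 0 := by
  obtain ⟨n, rfl⟩ := Nat.exists_eq_add_of_le' hn
  exact (CubicGood.hasDefect (fullGood_fin K (n + 3))).mono_card (by
    have := le_cubicCount n
    have e : (n + 3) * (n + 3 + 2) = (n + 3) * (n + 5) := by ring
    omega)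

end CubicSequences

section Independence

variable {K : Type} [Field K] [CharZero K]

theorem multichoose_succ_mul (n k : ℕ) :
    n.multichoose (k + 1) * (k + 1) = n.multichoose k * (n + k) := by
  cases n with
  | zero => cases k <;> simp
  | succ n =>
    rw [Nat.multichoose_eq, Nat.multichoose_eq, show n + 1 + (k + 1) - 1 = n + k + 1 by omega,
      show n + 1 + k - 1 = n + k by omega, ← Nat.add_one_mul_choose_eq]
    ring

theorem multichoose_three (n : ℕ) : n.multichoose 3 * 6 = n * (n + 1) * (n + 2) := by
  have h1 := multichoose_succ_mul n 1
  have h2 := multichoose_succ_mul n 2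
  norm_num at h1 h2
  calc _ = (n.multichoose 3 * 3) * 2 := by ring
    _ = (n.multichoose 2 * 2) * (n + 2) := by rw [h2]; ring
    _ = _ := by rw [h1]

theorem multichoose_four (n : ℕ) : n.multichoose 4 * 24 = n * (n + 1) * (n + 2) * (n + 3) := by
  have h1 := multichoose_three n
  have h2 := multichoose_succ_mul n 3
  norm_num at h2
  calc _ = (n.multichoose 4 * 4) * 6 := by ring
    _ = (n.multichoose 3 * 6) * (n + 3) := by rw [h2]; ring
    _ = _ := by rw [h1]

omit [CharZero K] in
theorem hasDefect_quadric_le {n k δ : ℕ} (h₁ : k ≤ n → k * (k - 1) / 2 ≤ δ)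
    (h₂ : n ≤ k → n * (n - 1) / 2 + (k - n) * n ≤ δ) : HasDefect K 1 n k δ := by
  rcases le_total k n with h | h
  · exact (hasDefect_quadric h).mono_right (h₁ h)
  · have := (hasDefect_quadric (K := K) (le_refl n)).add_card (k - n)
    rw [Nat.add_sub_cancel' h] at this
    exact this.mono_right (h₂ h)

omit [CharZero K] in
theorem HasDefect.of_le {e n k k' δ : ℕ} (h : HasDefect K e n k' 0) (hδ : (k - k') * n ≤ δ) :
    HasDefect K e n k δ := by
  rcases le_total k k' with hk | hk
  · exact (h.mono_card hk).mono_right (Nat.zero_le _)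
  · have := h.add_card (k - k')
    rw [Nat.add_sub_cancel' hk] at this
    exact this.mono_right (by omega)

theorem hasDefect_quartic_step {n q : ℕ} (hn : 2 ≤ n)
    (hu : ∀ u, u * (n + 1) ≤ n.multichoose 4 + n → HasDefect K 3 n u 0)
    (hk : ∀ k, k * (n + 2) ≤ (n + 1).multichoose 3 + (n + 1) → HasDefect K 2 (n + 1) k 0)
    (hq : q * (n + 2) ≤ (n + 1).multichoose 4 + (n + 1)) : HasDefect K 3 (n + 1) q 0 := by
  set R := n.multichoose 4 with hR
  set X := n.multichoose 3 with hX
  set Y := (n + 1).multichoose 2 with hY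
  have hS : (n + 1).multichoose 3 = X + Y := Nat.multichoose_succ_succ ..
  have hT : (n + 1).multichoose 4 = R + (X + Y) := by
    rw [← hS]; exact Nat.multichoose_succ_succ ..
  have hR24 : R * 24 = n * (n + 1) * (n + 2) * (n + 3) := multichoose_four n
  have hX6 : X * 6 = n * (n + 1) * (n + 2) := multichoose_three n
  have hY2 : Y * 2 = (n + 1) * (n + 2) := by
    have := multichoose_succ_mul (n + 1) 1
    norm_num at this
    exact this
  set v := (R + n) / (n + 1) with hv
  have hv1 : v * (n + 1) ≤ R + n := Nat.div_mul_le_self ..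
  have hv2 : R ≤ v * (n + 1) := by
    have := Nat.lt_mul_div_succ (R + n) (Nat.succ_pos n)
    rw [Nat.succ_eq_add_one, ← hv] at this
    nlinarith
  have hv24 : 24 * v < n * (n + 2) * (n + 3) + 24 := by
    have : 24 * v * (n + 1) < (n * (n + 2) * (n + 3) + 24) * (n + 1) := by nlinarith
    exact lt_of_mul_lt_mul_right this (Nat.zero_le _)
  have hvX : v + (n + 1) * n / 2 ≤ X + 1 ∧ (3 ≤ n → v + (n + 1) * n / 2 ≤ X) := by
    have h2 : (n + 1) * n / 2 * 2 ≤ (n + 1) * n := Nat.div_mul_le_self ..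
    rcases Nat.lt_or_ge n 4 with h4 | h4
    · interval_cases n <;> omega
    · obtain ⟨n, rfl⟩ := Nat.exists_eq_add_of_le h4
      have : v + (4 + n + 1) * (4 + n) / 2 ≤ X := by
        nlinarith [Nat.zero_le (n ^ 2), Nat.zero_le (n ^ 3)]
      exact ⟨by omega, fun _ => this⟩
  have hn3 : 3 ≤ (n + 1) * n / 2 := by
    rw [Nat.le_div_iff_mul_le (by norm_num)]; nlinarith
  rcases le_total q v with hqv | hqv
  · have h1 : q * (n + 1) ≤ R + n := (Nat.mul_le_mul_right _ hqv).trans hv1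
    exact HasDefect.horace (k := 0) (δ := 0) (hu q h1) (hk 0 (by simp))
      (hasDefect_quadric (Nat.zero_le _)) (by rw [← hX]; omega)
  · obtain ⟨k, rfl⟩ := Nat.exists_eq_add_of_le hqv
    have h1 : k * (n + 2) + v ≤ X + Y + (n + 1) := by rw [hT] at hq; nlinarith
    refine HasDefect.horace (δ := X - v) (hu v hv1)
      (hk k (by rw [hS]; exact (Nat.le_add_right _ v).trans h1)) ?_
      (by rw [← hX]; omega)
    refine hasDefect_quadric_le (fun h => ?_) fun h => ?_
    · rcases Nat.lt_or_ge n 3 with h3 | h3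
      · obtain rfl : n = 2 := by omega
        have : k ≤ 2 := by omega
        interval_cases k <;> omega
      · have h4 : k * (k - 1) / 2 ≤ (n + 1) * n / 2 :=
          Nat.div_le_div_right (Nat.mul_le_mul h (by omega))
        have := hvX.2 h3
        omega
    · obtain ⟨r, rfl⟩ := Nat.exists_eq_add_of_le h
      rw [Nat.add_sub_cancel_left, Nat.add_sub_cancel]
      have h2 : (n + 1) * n / 2 * 2 ≤ (n + 1) * n := Nat.div_mul_le_self ..
      have : (n + 1) * n / 2 + r * (n + 1) + v ≤ X := by nlinarith
      omega

theorem multichoose_three_left (k : ℕ) : Nat.multichoose 3 k * 2 = (k + 1) * (k + 2) := by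
  induction k with
  | zero => simp
  | succ k ih =>
    rw [Nat.multichoose_succ_succ, Nat.multichoose_two, add_mul, ih]
    ring

theorem multichoose_le_succ {n : ℕ} (hn : 1 ≤ n) (k : ℕ) :
    n.multichoose k ≤ n.multichoose (k + 1) := by
  have h := multichoose_succ_mul n k
  refine le_of_mul_le_mul_right (a := k + 1) ?_ (Nat.succ_pos k)
  rw [h]
  exact Nat.mul_le_mul_left _ (by omega)

theorem numeric_bound {n e u : ℕ} (hne : (4 ≤ n ∧ 1 ≤ e) ∨ (n = 3 ∧ 2 ≤ e) ∨ (n = 2 ∧ 7 ≤ e))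
    (hu : u * (n + 1) ≤ n.multichoose (e + 4) + n) :
    u + n * (n + 1) ≤ n.multichoose (e + 3) := by
  have hR := multichoose_succ_mul n (e + 3)
  have key : (e + 4) * n * (n ^ 2 + 2 * n + 2) ≤ n.multichoose (e + 3) * (e * n + 3 * n + 1) := by
    rcases hne with ⟨hn, he⟩ | ⟨rfl, he⟩ | ⟨rfl, he⟩
    · have h1 : n.multichoose 4 ≤ n.multichoose (e + 3) :=
        monotone_nat_of_le_succ (multichoose_le_succ (by omega)) (by omega)
      have h4 := multichoose_four n
      have h5 : (4 * n + 1) * (e + 4) ≤ 5 * (e * n + 3 * n + 1) := by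
        obtain ⟨e, rfl⟩ := Nat.exists_eq_add_of_le he
        obtain ⟨n, rfl⟩ := Nat.exists_eq_add_of_le hn
        nlinarith [Nat.zero_le (e * n)]
      have h6 : 120 * (n ^ 2 + 2 * n + 2) ≤ (n + 1) * (n + 2) * (n + 3) * (4 * n + 1) := by
        obtain ⟨n, rfl⟩ := Nat.exists_eq_add_of_le hn
        ring_nf
        nlinarith [Nat.zero_le (n ^ 2), Nat.zero_le (n ^ 3), Nat.zero_le (n ^ 4)]
      have h7 : 120 * ((e + 4) * n * (n ^ 2 + 2 * n + 2)) ≤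
          120 * (n.multichoose (e + 3) * (e * n + 3 * n + 1)) := calc
        _ = (e + 4) * n * (120 * (n ^ 2 + 2 * n + 2)) := by ring
        _ ≤ (e + 4) * n * ((n + 1) * (n + 2) * (n + 3) * (4 * n + 1)) := Nat.mul_le_mul_left _ h6
        _ = n * (n + 1) * (n + 2) * (n + 3) * ((4 * n + 1) * (e + 4)) := by ring
        _ = n.multichoose 4 * 24 * ((4 * n + 1) * (e + 4)) := by rw [h4]
        _ ≤ n.multichoose (e + 3) * 24 * (5 * (e * n + 3 * n + 1)) := by gcongr
        _ = _ := by ring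
      exact le_of_mul_le_mul_left h7 (by norm_num)
    · have h3 := multichoose_three_left (e + 3)
      obtain ⟨e, rfl⟩ := Nat.exists_eq_add_of_le he
      nlinarith [Nat.zero_le (e ^ 3), Nat.zero_le (e ^ 2)]
    · rw [Nat.multichoose_two]
      nlinarith
  have h : (n + 1) * (e + 4) * (u + n * (n + 1)) ≤ (n + 1) * (e + 4) * n.multichoose (e + 3) := calc
    _ = (e + 4) * (u * (n + 1)) + (e + 4) * n * (n + 1) ^ 2 := by ring
    _ ≤ (e + 4) * (n.multichoose (e + 4) + n) + (e + 4) * n * (n + 1) ^ 2 := by gcongr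
    _ = n.multichoose (e + 3 + 1) * (e + 3 + 1) + (e + 4) * n * (n ^ 2 + 2 * n + 2) := by ring
    _ ≤ n.multichoose (e + 3) * (n + (e + 3)) +
        n.multichoose (e + 3) * (e * n + 3 * n + 1) := by rw [hR]; gcongr
    _ = _ := by ring
  exact le_of_mul_le_mul_left h (by positivity)

theorem hasDefect_general_step {n e q : ℕ}
    (hne : (4 ≤ n ∧ 1 ≤ e) ∨ (n = 3 ∧ 2 ≤ e) ∨ (n = 2 ∧ 7 ≤ e))
    (hu : ∀ u, u * (n + 1) ≤ n.multichoose (e + 4) + n → HasDefect K (e + 3) n u 0)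
    (hk : ∀ k, k * (n + 2) ≤ (n + 1).multichoose (e + 3) + (n + 1) →
      HasDefect K (e + 2) (n + 1) k 0)
    (hδ : ∀ k, k * (n + 2) ≤ (n + 1).multichoose (e + 2) + (n + 1) →
      HasDefect K (e + 1) (n + 1) k 0)
    (hq : q * (n + 2) ≤ (n + 1).multichoose (e + 4) + (n + 1)) :
    HasDefect K (e + 3) (n + 1) q 0 := by
  set R := n.multichoose (e + 4) with hR
  set X := n.multichoose (e + 3) with hX
  set Y := (n + 1).multichoose (e + 2) with hY
  have hS : (n + 1).multichoose (e + 3) = X + Y := Nat.multichoose_succ_succ ..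
  have hT : (n + 1).multichoose (e + 4) = R + (X + Y) := by
    rw [← hS]; exact Nat.multichoose_succ_succ ..
  set v := (R + n) / (n + 1) with hv
  set k' := (Y + (n + 1)) / (n + 2) with hk'
  have hv1 : v * (n + 1) ≤ R + n := Nat.div_mul_le_self ..
  have hv2 : R ≤ v * (n + 1) := by
    have := Nat.lt_mul_div_succ (R + n) (Nat.succ_pos n)
    rw [Nat.succ_eq_add_one, ← hv] at this
    nlinarith
  have hk1 : k' * (n + 2) ≤ Y + (n + 1) := Nat.div_mul_le_self ..
  have hk2 : Y ≤ k' * (n + 2) := by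
    have := Nat.lt_mul_div_succ (Y + (n + 1)) (Nat.succ_pos (n + 1))
    rw [Nat.succ_eq_add_one, ← hk'] at this
    nlinarith
  have hvX := numeric_bound hne hv1
  rcases le_total q v with hqv | hqv
  · have h1 : q * (n + 1) ≤ R + n := (Nat.mul_le_mul_right _ hqv).trans hv1
    refine HasDefect.horace (k := 0) (δ := 0) (hu q h1) (hk 0 (by simp)) (hδ 0 (by simp)) ?_
    rw [← hX]; omega
  · obtain ⟨k, rfl⟩ := Nat.exists_eq_add_of_le hqv
    have h1 : k * (n + 2) + v ≤ X + Y + (n + 1) := by rw [hT] at hq; nlinarith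
    refine HasDefect.horace (hu v hv1)
      (hk k (by rw [hS]; exact (Nat.le_add_right _ v).trans h1)) ((hδ k' hk1).of_le le_rfl) ?_
    rw [← hX]
    rcases le_total k k' with h | h
    · rw [Nat.sub_eq_zero_of_le h]; omega
    · obtain ⟨r, rfl⟩ := Nat.exists_eq_add_of_le h
      rw [Nat.add_sub_cancel_left]
      have h3 : r * (n + 2) + v ≤ X + (n + 1) := by nlinarith
      have h4 : (v + r * (n + 1)) * (n + 2) < (X + 1) * (n + 2) := by nlinarith
      have := lt_of_mul_lt_mul_right h4 (Nat.zero_le _)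
      omega

variable (K) in
/-- Generic points impose independent conditions in the range of degrees used below. -/
theorem hasDefect_zero_of_le (e : ℕ) : ∀ n q : ℕ, 2 ≤ e → 1 ≤ n →
    q * (n + 1) ≤ n.multichoose (e + 1) + n → HasDefect K e n q 0 := by
  induction e using Nat.strong_induction_on with
  | _ e ihe =>
  intro n
  induction n with
  | zero => exact fun q _ h => absurd h (by norm_num)
  | succ n ihn =>
  intro q he _ hq
  rcases Nat.lt_or_ge n 2 with hn | hn
  · interval_cases n
    · exact (hasDefect_one_point e 0).mono_card (by simp at hq; omega)
    · exact hasDefect_binary e q (by rw [Nat.multichoose_two] at hq; omega)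
  obtain rfl | he := he.eq_or_lt
  · refine hasDefect_cubic (by omega) ?_
    have h3 := multichoose_three (n + 1)
    have : (6 * q) * (n + 2) < ((n + 1) * (n + 1 + 2) + 6) * (n + 2) := by nlinarith
    have := lt_of_mul_lt_mul_right this (Nat.zero_le _)
    omega
  obtain ⟨e, rfl⟩ := Nat.exists_eq_add_of_le' he
  have hu := fun u h => ihn u (by omega) (by omega) h
  have hk := fun k h => ihe (e + 2) (by omega) (n + 1) k (by omega) (by omega) h
  rcases Nat.eq_zero_or_pos e with rfl | he1
  · exact hasDefect_quartic_step hn hu hk hq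
  have hδ := fun k h => ihe (e + 1) (by omega) (n + 1) k (by omega) (by omega) h
  by_cases hne : (4 ≤ n ∧ 1 ≤ e) ∨ (n = 3 ∧ 2 ≤ e) ∨ (n = 2 ∧ 7 ≤ e)
  · exact hasDefect_general_step hne hu hk hδ hq
  have : (n = 3 ∧ e = 1) ∨ (n = 2 ∧ 1 ≤ e ∧ e ≤ 6) := by omega
  have finish : ∀ u k k' : ℕ, HasDefect K (e + 3) n u 0 →
      k * (n + 2) ≤ (n + 1).multichoose (e + 3) + (n + 1) →
      k' * (n + 2) ≤ (n + 1).multichoose (e + 2) + (n + 1) →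
      u + (k - k') * (n + 1) ≤ n.multichoose (e + 3) → q ≤ u + k →
      HasDefect K (e + 3) (n + 1) q 0 := fun u k k' h₁ h₂ h₃ h₄ h₅ =>
    (h₁.horace (hk k h₂) ((hδ k' h₃).of_le le_rfl) h₄).mono_card h₅
  rcases this with ⟨rfl, rfl⟩ | ⟨rfl, h1, h6⟩
  · have h4 : Nat.multichoose 4 5 = 56 := by norm_num [Nat.multichoose_eq, Nat.choose]
    norm_num [h4] at hq
    apply finish 6 6 4 (hu 6 (by norm_num [Nat.multichoose_eq, Nat.choose])) <;>
      first | omega | norm_num [Nat.multichoose_eq, Nat.choose]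
  have h3 := multichoose_three_left (e + 4)
  norm_num at hq
  interval_cases e <;> norm_num at hq h3
  · apply finish 3 3 3 (hasDefect_binary _ _ (by norm_num)) <;>
      first | omega | norm_num [Nat.multichoose_eq, Nat.choose]
  · apply finish 3 4 4 (hasDefect_binary _ _ (by norm_num)) <;>
      first | omega | norm_num [Nat.multichoose_eq, Nat.choose]
  · apply finish 4 5 5 (hasDefect_binary _ _ (by norm_num)) <;>
      first | omega | norm_num [Nat.multichoose_eq, Nat.choose]
  · apply finish 4 8 7 (hasDefect_binary _ _ (by norm_num)) <;>
      first | omega | norm_num [Nat.multichoose_eq, Nat.choose]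
  · apply finish 5 9 9 (hasDefect_binary _ _ (by norm_num)) <;>
      first | omega | norm_num [Nat.multichoose_eq, Nat.choose]
  · apply finish 5 12 12 (hasDefect_binary _ _ (by norm_num)) <;>
      first | omega | norm_num [Nat.multichoose_eq, Nat.choose]

end Independence

section Forms

variable {K : Type} [Field K]

instance finite_homogeneousSubmodule (n d : ℕ) :
    FiniteDimensional K (homogeneousSubmodule (Fin n) K d) :=
  Module.Finite.iff_fg.mpr (homogeneousSubmodule_fg (Fin n) K d)

theorem finrank_homogeneousSubmodule (n d : ℕ) :
    Module.finrank K (homogeneousSubmodule (Fin n) K d) = n.multichoose d := by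
  have h1 : {x : Fin n →₀ ℕ | x.degree = d} =
      ((Finset.univ.finsuppAntidiag d : Finset (Fin n →₀ ℕ)) : Set (Fin n →₀ ℕ)) := by
    ext x
    simp [Finsupp.degree_eq_sum]
  have h2 := (LinearEquiv.ofEq _ _ (homogeneousSubmodule_eq_finsupp_supported (Fin n) K d)).trans
    (AddMonoidAlgebra.supportedEquivFinsupp {x : Fin n →₀ ℕ | x.degree = d})
  rw [h2.finrank_eq, h1]
  rw [Module.finrank_finsupp_self]
  simp [Finset.card_finsuppAntidiag_nat_eq_multichoose]

theorem eval_mem_subalgebra {X ι : Type*} (A : Subalgebra K (X → K)) (φ : ι → X → K)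
    (hφ : ∀ i, φ i ∈ A) (F : MvPolynomial ι K) : (fun x => eval (fun i => φ i x) F) ∈ A := by
  induction F using MvPolynomial.induction_on with
  | C a =>
    simp only [eval_C]
    exact A.algebraMap_mem a
  | add p q hp hq =>
    simp only [map_add]
    exact A.add_mem hp hq
  | mul_X p i hp =>
    simp only [map_mul, eval_X]
    exact A.mul_mem hp (hφ i)

/-- Evaluation at a point as a linear form. -/
def evalLinear {ι : Type*} (x : ι → K) : MvPolynomial ι K →ₗ[K] K := (aeval x).toLinearMap

@[simp]
theorem evalLinear_apply {ι : Type*} (x : ι → K) (F : MvPolynomial ι K) :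
    evalLinear x F = eval x F := by
  simp [evalLinear]

variable {n d q t : ℕ}

/-- The gradients at finitely many points. -/
def gradients (p : Fin q → Fin n → K) :
    homogeneousSubmodule (Fin n) K d →ₗ[K] (Fin q × Fin n → K) :=
  (LinearMap.pi fun ji : Fin q × Fin n => evalLinear (p ji.1) ∘ₗ (pderiv ji.2).toLinearMap) ∘ₗ
    (homogeneousSubmodule (Fin n) K d).subtype

/-- The gradients at some points and the values at others. -/
def formConditions (p p' : Fin q → Fin n → K) (w : Fin t → Fin n → K) :
    homogeneousSubmodule (Fin n) K d →ₗ[K] (Fin q × Fin n ⊕ Fin q ⊕ Fin t → K) :=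
  (LinearMap.pi (Sum.elim (fun ji => evalLinear (p ji.1) ∘ₗ (pderiv ji.2).toLinearMap)
    (Sum.elim (fun j => evalLinear (p' j)) (fun j => evalLinear (w j))))) ∘ₗ
    (homogeneousSubmodule (Fin n) K d).subtype

theorem mem_ker_gradients (p : Fin q → Fin n → K) (F : homogeneousSubmodule (Fin n) K d) :
    F ∈ LinearMap.ker (gradients p) ↔ ∀ j i, eval (p j) (pderiv i F.1) = 0 := by
  simp [gradients, _root_.funext_iff]

theorem mem_ker_formConditions (p p' : Fin q → Fin n → K) (w : Fin t → Fin n → K)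
    (F : homogeneousSubmodule (Fin n) K d) :
    F ∈ LinearMap.ker (formConditions p p' w) ↔ (∀ j i, eval (p j) (pderiv i F.1) = 0) ∧
      (∀ j, eval (p' j) F.1 = 0) ∧ ∀ j, eval (w j) F.1 = 0 := by
  simp [formConditions, _root_.funext_iff]

theorem isHomogeneous_dual (y : Fin n → K) : (∑ i, C (y i) * X i : MvPolynomial (Fin n) K)
    |>.IsHomogeneous 1 :=
  IsHomogeneous.sum _ _ _ fun i _ => (isHomogeneous_X K i).C_mul (y i)

theorem finrank_ker_gradients [CharZero K] {e : ℕ} (p : Fin q → Fin n → K)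
    (hp : Module.finrank K (LinearMap.ker (veroneseTangent e p)) ≤ 0) :
    Module.finrank K (LinearMap.ker (gradients (d := e + 1) p)) + q * n =
      n.multichoose (e + 1) := by
  rw [finrank_ker_le_zero] at hp
  have hsurj : LinearMap.range (gradients (d := e + 1) p) = ⊤ := by
    by_contra hne
    obtain ⟨f, hf, hle⟩ := Submodule.exists_le_ker_of_lt_top _ (lt_top_iff_ne_top.mpr hne)
    refine hf ?_
    let c : Fin q → Fin n → K := fun j i => f (Pi.single (j, i) 1)
    have hfc : ∀ v, f v = ∑ j, ∑ i, v (j, i) * c j i := by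
      intro v
      rw [← Finset.sum_product', Finset.univ_product_univ]
      conv_lhs => rw [pi_eq_sum_univ' v]
      simp [c]
    have hc : c = 0 := by
      refine hp c (funext fun y => ?_)
      have h := LinearMap.mem_ker.mp
        (hle ⟨⟨_, (one_mul (e + 1) ▸ (isHomogeneous_dual y).pow (e + 1) :)⟩, rfl⟩)
      rw [hfc] at h
      simp only [gradients, LinearMap.comp_apply, Submodule.subtype_apply, LinearMap.pi_apply,
        Derivation.coeFn_coe, evalLinear_apply, Derivation.leibniz_pow, map_sum,
        pderiv_C_mul, pderiv_X] at h
      simp [Pi.single_apply] at h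
      rw [veroneseTangent_apply]
      have he : (e + 1 : K) ≠ 0 := by exact_mod_cast e.succ_ne_zero
      refine mul_left_cancel₀ he ?_
      rw [Pi.zero_apply, mul_zero, ← h, Finset.mul_sum]
      refine Finset.sum_congr rfl fun j _ => ?_
      simp only [dotProduct, Finset.mul_sum]
      refine Finset.sum_congr rfl fun i _ => ?_
      simp only [mul_comm (y _)]
      ring
    ext v
    simp [hfc, hc]
  have h := LinearMap.finrank_range_add_finrank_ker (gradients (d := e + 1) p)
  rw [hsurj, finrank_top, finrank_homogeneousSubmodule] at h
  simp at h
  omega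

/-- The values at finitely many points. -/
def values (w : Fin t → Fin n → K) : homogeneousSubmodule (Fin n) K d →ₗ[K] (Fin t → K) :=
  (LinearMap.pi fun j => evalLinear (w j)) ∘ₗ (homogeneousSubmodule (Fin n) K d).subtype

theorem mem_ker_values (w : Fin t → Fin n → K) (F : homogeneousSubmodule (Fin n) K d) :
    F ∈ LinearMap.ker (values w) ↔ ∀ j, eval (w j) F.1 = 0 := by
  simp [values, _root_.funext_iff]

theorem exists_finrank_inf_ker_values_le [CharZero K]
    (S : Submodule K (homogeneousSubmodule (Fin n) K d)) (r : ℕ) :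
    ∃ w : Fin r → Fin n → K, Module.finrank K (S ⊓ LinearMap.ker (values w) :
        Submodule K (homogeneousSubmodule (Fin n) K d)) ≤ Module.finrank K S - r := by
  induction r with
  | zero => exact ⟨Fin.elim0, Submodule.finrank_mono inf_le_left⟩
  | succ r ih =>
    obtain ⟨w, hw⟩ := ih
    have hle : ∀ z, S ⊓ LinearMap.ker (values (Fin.snoc w z : Fin (r + 1) → Fin n → K)) ≤
        S ⊓ LinearMap.ker (values w) := by
      rintro z F ⟨hF, hF'⟩
      refine ⟨hF, (mem_ker_values _ _).mpr fun j => ?_⟩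
      simpa using (mem_ker_values _ _).mp hF' j.castSucc
    by_cases h0 : S ⊓ LinearMap.ker (values w) = ⊥
    · refine ⟨Fin.snoc w 0, (Submodule.finrank_mono (hle 0)).trans ?_⟩
      rw [h0, finrank_bot]
      exact Nat.zero_le _
    · obtain ⟨F, hF, hF0⟩ := Submodule.exists_mem_ne_zero_of_ne_bot h0
      obtain ⟨z, hz⟩ : ∃ z, eval z F.1 ≠ 0 := by
        by_contra! h
        exact hF0 (Subtype.ext (MvPolynomial.funext fun z => by simpa using h z))
      have hlt := Submodule.finrank_lt_finrank_of_lt (lt_of_le_of_ne (hle z) fun heq => by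
        rw [← heq] at hF
        exact hz (by simpa using (mem_ker_values _ _).mp hF.2 (Fin.last r)))
      exact ⟨Fin.snoc w z, by omega⟩

variable (K) in
theorem exists_finrank_ker_formConditions_le [CharZero K] (hn : 1 ≤ n) (hd : 3 ≤ d) (q t : ℕ) :
    ∃ (p p' : Fin q → Fin n → K) (w : Fin t → Fin n → K),
      Module.finrank K (LinearMap.ker (formConditions (d := d) p p' w)) ≤
        n.multichoose d - q * (n + 1) - t := by
  obtain ⟨e, rfl⟩ : ∃ e, d = e + 1 := ⟨d - 1, by omega⟩
  obtain ⟨p, hp⟩ : ∃ p : Fin q → Fin n → K,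
      Module.finrank K (LinearMap.ker (gradients (d := e + 1) p)) ≤
        max (n.multichoose (e + 1) - q * n) q := by
    set v := (n.multichoose (e + 1) + n) / (n + 1) with hv
    have hv1 : v * (n + 1) ≤ n.multichoose (e + 1) + n := Nat.div_mul_le_self ..
    have hv2 : n.multichoose (e + 1) ≤ v * (n + 1) := by
      have := Nat.lt_mul_div_succ (n.multichoose (e + 1) + n) (Nat.succ_pos n)
      rw [Nat.succ_eq_add_one, ← hv] at this
      nlinarith
    rcases le_total q v with hqv | hqv
    · obtain ⟨p, hp⟩ := hasDefect_zero_of_le K e n q (by omega) hn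
        ((Nat.mul_le_mul_right _ hqv).trans hv1)
      have := finrank_ker_gradients p hp
      exact ⟨p, by omega⟩
    · obtain ⟨p, hp⟩ := hasDefect_zero_of_le K e n v (by omega) hn hv1
      have h := finrank_ker_gradients p hp
      refine ⟨fun j => if hj : j.1 < v then p ⟨j, hj⟩ else 0, le_max_of_le_right ?_⟩
      refine (Submodule.finrank_mono (t := LinearMap.ker (gradients (d := e + 1) p)) ?_).trans ?_
      · intro F hF
        rw [mem_ker_gradients] at hF ⊢
        intro j i
        simpa using hF (Fin.castLE hqv j) i
      · nlinarith
  obtain ⟨w, hw⟩ := exists_finrank_inf_ker_values_le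
    (LinearMap.ker (gradients (d := e + 1) p)) (q + t)
  refine ⟨p, fun j => w (Fin.castAdd t j), fun j => w (Fin.natAdd q j), ?_⟩
  refine (Submodule.finrank_mono ?_).trans (hw.trans ?_)
  · intro F hF
    rw [mem_ker_formConditions] at hF
    refine ⟨(mem_ker_gradients _ _).mpr hF.1, (mem_ker_values _ _).mpr fun j => ?_⟩
    induction j using Fin.addCases with
    | left j => exact hF.2.1 j
    | right j => exact hF.2.2 j
  · rw [mul_add, mul_one]
    omega

theorem lineOpen_formConditions [CharZero K] (N : ℕ) :
    LineOpen K fun x : (Fin q → Fin n → K) × (Fin q → Fin n → K) × (Fin t → Fin n → K) =>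
      Module.finrank K (LinearMap.ker (formConditions (d := d) x.1 x.2.1 x.2.2)) ≤ N := by
  refine lineOpen_finrank_ker_le (fun x : (Fin q → Fin n → K) × (Fin q → Fin n → K) ×
    (Fin t → Fin n → K) => formConditions (d := d) x.1 x.2.1 x.2.2) ?_ N
  have hpt : ∀ {r : ℕ} (φ : ((Fin q → Fin n → K) × (Fin q → Fin n → K) × (Fin t → Fin n → K)) →ₗ[K]
      (Fin r → Fin n → K)) (j : Fin r) (F : MvPolynomial (Fin n) K),
      (fun x => eval (φ x j) F) ∈ linePoly K _ := fun φ j F =>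
    eval_mem_subalgebra _ (fun i x => φ x j i)
      (fun i => linearMap_mem_linePoly (LinearMap.proj i ∘ₗ LinearMap.proj j ∘ₗ φ)) F
  rintro F (⟨j, i⟩ | j | j)
  · simpa [formConditions] using hpt (LinearMap.fst K _ _) j (pderiv i F.1)
  · simpa [formConditions] using hpt (LinearMap.fst K _ _ ∘ₗ LinearMap.snd K _ _) j F.1
  · simpa [formConditions] using hpt (LinearMap.snd K _ _ ∘ₗ LinearMap.snd K _ _) j F.1

variable (K) in
/-- Simultaneous independence of a configuration and of the configuration in which the roles of
the two groups of points are exchanged. -/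
theorem exists_symmetric_configuration [CharZero K] (hd : 3 ≤ d) (l : Fin n) (q t : ℕ) :
    ∃ (p p' : Fin q → Fin n → K) (w : Fin t → Fin n → K),
      Module.finrank K (LinearMap.ker (formConditions (d := d) p p' w)) ≤
        n.multichoose d - q * (n + 1) - t ∧
      Module.finrank K (LinearMap.ker (formConditions (d := d) p' p w)) ≤
        n.multichoose d - q * (n + 1) - t ∧
      (∀ j, p j l ≠ 0) ∧ (∀ j, p' j l ≠ 0) ∧ ∀ j, w j l ≠ 0 := by
  obtain ⟨p, p', w, h⟩ := exists_finrank_ker_formConditions_le K l.pos hd q t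
  let E := (Fin q → Fin n → K) × (Fin q → Fin n → K) × (Fin t → Fin n → K)
  let swap : E →ₗ[K] E := (LinearMap.fst K _ _ ∘ₗ LinearMap.snd K _ _).prod
    ((LinearMap.fst K _ _).prod (LinearMap.snd K _ _ ∘ₗ LinearMap.snd K _ _))
  set N := n.multichoose d - q * (n + 1) - t
  have o1 := lineOpen_formConditions (K := K) (n := n) (d := d) (q := q) (t := t) N
  have o2 := o1.comp swap
  have oc (r : ℕ) (φ : E →ₗ[K] (Fin r → Fin n → K)) :
      LineOpen K fun x : E => ∀ j, φ x j l ≠ 0 :=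
    LineOpen.comp (P := fun y : Fin r → Fin n → K => ∀ j, y j l ≠ 0)
      (LineOpen.forall fun j => lineOpen_coord_ne_zero j l) φ
  have o3 := oc q (LinearMap.fst K _ _)
  have o4 := oc q (LinearMap.fst K _ _ ∘ₗ LinearMap.snd K _ _)
  have o5 := oc t (LinearMap.snd K _ _ ∘ₗ LinearMap.snd K _ _)
  obtain ⟨x, h1, h2, h3, h4, h5⟩ := o1.exists_and (o2.and (o3.and (o4.and o5))) ⟨(p, p', w), h⟩
    (o2.exists_and (o3.and (o4.and o5)) ⟨(p', p, w), h⟩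
      ⟨(fun _ _ => 1, fun _ _ => 1, fun _ _ => 1), fun _ => one_ne_zero, fun _ => one_ne_zero,
        fun _ => one_ne_zero⟩)
  exact ⟨x.1, x.2.1, x.2.2, h1, h2, h3, h4, h5⟩

end Forms

section LinearIdeals

variable {K : Type} [Field K]

theorem aeval_sub_aeval_mem {σ S : Type*} [CommRing S] [Algebra K S] (I : Ideal S) (u v : σ → S)
    (h : ∀ i, u i - v i ∈ I) (F : MvPolynomial σ K) : aeval u F - aeval v F ∈ I := by
  rw [← Ideal.Quotient.eq]
  have hu (u : σ → S) : Ideal.Quotient.mk I (aeval u F) =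
      aeval (fun i => Ideal.Quotient.mk I (u i)) F :=
    DFunLike.congr_fun (comp_aeval u (Ideal.Quotient.mkₐ K I)) F
  rw [hu, hu]
  congr 2
  funext i
  exact Ideal.Quotient.eq.mpr (h i)

/-- The first order Taylor formula modulo the square of an ideal. -/
theorem aeval_sub_aeval_sub_sum_mem_sq {σ S : Type*} [Fintype σ] [CommRing S] [Algebra K S]
    (I : Ideal S) (u v : σ → S) (h : ∀ i, u i - v i ∈ I) (F : MvPolynomial σ K) :
    aeval u F - aeval v F - ∑ j, (u j - v j) * aeval v (pderiv j F) ∈ I ^ 2 := by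
  classical
  induction F using MvPolynomial.induction_on with
  | C a => simp
  | add p r hp hr =>
    convert add_mem hp hr using 1
    simp only [map_add, mul_add, Finset.sum_add_distrib]
    ring
  | mul_X p i hp =>
    have h1 := (I ^ 2).mul_mem_left (v i) hp
    have h2 : (aeval u p - aeval v p) * (u i - v i) ∈ I ^ 2 :=
      sq I ▸ Ideal.mul_mem_mul (aeval_sub_aeval_mem I u v h p) (h i)
    convert add_mem h1 h2 using 1
    have h3 : ∑ j, (u j - v j) * aeval v (pderiv j (p * X i)) =
        v i * ∑ j, (u j - v j) * aeval v (pderiv j p) + aeval v p * (u i - v i) := by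
      simp only [Derivation.leibniz, pderiv_X, smul_eq_mul, map_add, map_mul, aeval_X, mul_add,
        Finset.sum_add_distrib, Finset.mul_sum]
      rw [add_comm]
      congr 1
      · exact Finset.sum_congr rfl fun j _ => by ring
      · rw [Finset.sum_eq_single i]
        · simp [mul_comm]
        · intro j _ hj
          simp [Pi.single_eq_of_ne' hj]
        · simp
    rw [h3]
    simp only [map_mul, aeval_X]
    ring

theorem aeval_mul_C_of_isHomogeneous {σ : Type*} {D : ℕ} {F : MvPolynomial σ K}
    (hF : F.IsHomogeneous D) (l : MvPolynomial σ K) (z : σ → K) :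
    aeval (fun i => l * C (z i)) F = l ^ D * C (eval z F) := by
  rw [eval_eq, map_sum, aeval_def, eval₂_eq, Finset.mul_sum]
  refine Finset.sum_congr rfl fun e he => ?_
  have hd : ∑ i ∈ e.support, e i = D := by
    exact hF.degree_eq_sum_deg_support he |>.symm
  simp only [mul_pow, Finset.prod_mul_distrib, Finset.prod_pow_eq_pow_sum, hd, map_mul, map_prod,
    map_pow, algebraMap_eq]
  ring

variable {n : ℕ}

/-- The linear form attached to a linear functional. -/
def linearForm (φ : (Fin n → K) →ₗ[K] K) : MvPolynomial (Fin n) K :=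
  ∑ j, C (φ (Pi.single j 1)) * X j

@[simp]
theorem eval_linearForm (φ : (Fin n → K) →ₗ[K] K) (x : Fin n → K) :
    eval x (linearForm φ) = φ x := by
  conv_rhs => rw [pi_eq_sum_univ' x]
  simp [linearForm, mul_comm]

theorem isHomogeneous_linearForm (φ : (Fin n → K) →ₗ[K] K) : (linearForm φ).IsHomogeneous 1 :=
  isHomogeneous_dual _

theorem exists_eval_eq_of_isHomogeneous_one {f : MvPolynomial (Fin n) K}
    (hf : f.IsHomogeneous 1) : ∃ φ : (Fin n → K) →ₗ[K] K, ∀ x, eval x f = φ x := by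
  rw [← mem_homogeneousSubmodule, homogeneousSubmodule_one_eq_span_X,
    Submodule.mem_span_range_iff_exists_fun] at hf
  obtain ⟨c, rfl⟩ := hf
  refine ⟨∑ i, c i • LinearMap.proj i, fun x => ?_⟩
  simp [smul_eval]

theorem linearForm_mem_linIdeal {S : Set (Fin n → K)} (φ : (Fin n → K) →ₗ[K] K)
    (h : ∀ x ∈ S, φ x = 0) : linearForm φ ∈ linIdeal K S :=
  Ideal.subset_span ⟨isHomogeneous_linearForm φ, fun x hx => by simpa using h x hx⟩

theorem eval_eq_zero_of_mem_linIdeal {S : Set (Fin n → K)} {F : MvPolynomial (Fin n) K}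
    (hF : F ∈ linIdeal K S) {x : Fin n → K} (hx : x ∈ Submodule.span K S) : eval x F = 0 := by
  suffices linIdeal K S ≤ RingHom.ker (eval x) from this hF
  refine Ideal.span_le.mpr ?_
  rintro f ⟨hf, hfS⟩
  obtain ⟨φ, hφ⟩ := exists_eval_eq_of_isHomogeneous_one hf
  have hle : Submodule.span K S ≤ LinearMap.ker φ :=
    Submodule.span_le.mpr fun y hy => by simpa [← hφ] using hfS y hy
  simpa [hφ] using hle hx

/-- A linear change of coordinates on polynomials. -/
def linSubst {n' : ℕ} (T : (Fin n → K) →ₗ[K] (Fin n' → K)) :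
    MvPolynomial (Fin n') K →ₐ[K] MvPolynomial (Fin n) K :=
  aeval fun i => linearForm (LinearMap.proj i ∘ₗ T)

@[simp]
theorem eval_linSubst {n' : ℕ} (T : (Fin n → K) →ₗ[K] (Fin n' → K)) (F : MvPolynomial (Fin n') K)
    (x : Fin n → K) : eval x (linSubst T F) = eval (T x) F := by
  induction F using MvPolynomial.induction_on with
  | C a => simp [linSubst]
  | add p q hp hq => simp [hp, hq]
  | mul_X p i hp =>
    rw [map_mul, map_mul, hp, linSubst, aeval_X]
    simp

theorem isHomogeneous_linSubst {n' D : ℕ} (T : (Fin n → K) →ₗ[K] (Fin n' → K))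
    {F : MvPolynomial (Fin n') K} (hF : F.IsHomogeneous D) : (linSubst T F).IsHomogeneous D := by
  have h := hF.aeval (fun i => linearForm (LinearMap.proj i ∘ₗ T))
    fun i => isHomogeneous_linearForm _
  rwa [one_mul] at h

theorem linSubst_mem_pow {n' D : ℕ} (T : (Fin n → K) →ₗ[K] (Fin n' → K)) {S : Set (Fin n → K)}
    {S' : Set (Fin n' → K)} (h : ∀ x ∈ S, T x ∈ Submodule.span K S') {F : MvPolynomial (Fin n') K}
    (hF : F ∈ linIdeal K S' ^ D) : linSubst T F ∈ linIdeal K S ^ D := by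
  suffices (linIdeal K S').map (linSubst T).toRingHom ≤ linIdeal K S from
    Ideal.pow_right_mono this D (Ideal.map_pow (linSubst T).toRingHom _ D ▸
      Ideal.mem_map_of_mem (linSubst T).toRingHom hF)
  rw [linIdeal, Ideal.map_span, Ideal.span_le]
  rintro _ ⟨f, hf, rfl⟩
  refine Ideal.subset_span ⟨isHomogeneous_linSubst T hf.1, fun x hx => ?_⟩
  have := eval_eq_zero_of_mem_linIdeal (Ideal.subset_span hf) (h x hx)
  simpa using this

theorem linSubst_symm_linSubst [Infinite K] (T : (Fin n → K) ≃ₗ[K] (Fin n → K))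
    (F : MvPolynomial (Fin n) K) :
    linSubst T.symm.toLinearMap (linSubst T.toLinearMap F) = F :=
  MvPolynomial.funext fun x => by simp

theorem linSubst_mem_pow_iff [Infinite K] {D : ℕ} (T : (Fin n → K) ≃ₗ[K] (Fin n → K))
    {S S' : Set (Fin n → K)} (h : ∀ x ∈ S, T x ∈ Submodule.span K S')
    (h' : ∀ x ∈ S', T.symm x ∈ Submodule.span K S) {F : MvPolynomial (Fin n) K} :
    linSubst T.toLinearMap F ∈ linIdeal K S ^ D ↔ F ∈ linIdeal K S' ^ D := by
  refine ⟨fun hF => ?_, linSubst_mem_pow _ h⟩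
  rw [← linSubst_symm_linSubst T F]
  exact linSubst_mem_pow _ h' hF

theorem mem_linIdeal_iff [Infinite K] {S : Set (Fin n → K)} {F : MvPolynomial (Fin n) K} :
    F ∈ linIdeal K S ↔ ∀ x ∈ Submodule.span K S, eval x F = 0 := by
  refine ⟨fun hF x hx => eval_eq_zero_of_mem_linIdeal hF hx, fun hF => ?_⟩
  obtain ⟨g, hg⟩ := (Submodule.span K S).subtype.exists_leftInverse_of_injective (by simp)
  let T := (Submodule.span K S).subtype ∘ₗ g
  have hT : ∀ x ∈ S, T x = x := fun x hx => by
    have := DFunLike.congr_fun hg ⟨x, Submodule.subset_span hx⟩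
    simpa [T] using congrArg Subtype.val this
  have h0 : linSubst T F = 0 := MvPolynomial.funext fun x => by
    simpa using hF (T x) (g x).2
  have h1 := aeval_sub_aeval_mem (linIdeal K S) X
    (fun i => linearForm (LinearMap.proj i ∘ₗ T)) (fun i => ?_) F
  · rw [aeval_X_left_apply] at h1
    change F - linSubst T F ∈ _ at h1
    rwa [h0, sub_zero] at h1
  · have h2 : (X i : MvPolynomial (Fin n) K) = linearForm (LinearMap.proj i) :=
      MvPolynomial.funext fun x => by simp
    have h3 : X i - linearForm (LinearMap.proj i ∘ₗ T) =
        linearForm (LinearMap.proj i - LinearMap.proj i ∘ₗ T) :=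
      MvPolynomial.funext fun x => by simp
    rw [h3]
    exact linearForm_mem_linIdeal _ fun x hx => by simp [hT x hx]

theorem mem_linIdeal_singleton_sq_iff [CharZero K] {D : ℕ} (hD : 2 ≤ D) (z : Fin n → K)
    {F : MvPolynomial (Fin n) K} (hF : F.IsHomogeneous D) :
    F ∈ linIdeal K {z} ^ 2 ↔ ∀ i, eval z (pderiv i F) = 0 := by
  constructor
  · intro h i
    rw [sq] at h
    refine (Submodule.mul_induction_on (C := fun G => eval z G = 0 ∧ eval z (pderiv i G) = 0) h
      ?_ ?_).2
    · intro G hG H hH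
      have hG := eval_eq_zero_of_mem_linIdeal hG (Submodule.mem_span_singleton_self z)
      have hH := eval_eq_zero_of_mem_linIdeal hH (Submodule.mem_span_singleton_self z)
      simp [hG, hH]
    · intro G H hG hH
      simp [hG, hH]
  · intro h
    have h0 : eval z F = 0 := by
      have h1 := congrArg (eval z) hF.sum_X_mul_pderiv
      have hD0 : D ≠ 0 := by omega
      simpa [h, hD0] using h1.symm
    obtain ⟨φ, hφ⟩ : ∃ φ : (Fin n → K) →ₗ[K] K, ∀ i, z i - φ z * z i = 0 := by
      by_cases hz : z = 0
      · exact ⟨0, by simp [hz]⟩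
      · obtain ⟨j, hj⟩ := Function.ne_iff.mp hz
        refine ⟨(z j)⁻¹ • LinearMap.proj j, fun i => ?_⟩
        simp [inv_mul_cancel₀ hj]
    have h1 := aeval_sub_aeval_sub_sum_mem_sq (linIdeal K {z}) X
      (fun i => linearForm φ * C (z i)) (fun i => ?_) F
    · have h2 : ∀ i, aeval (fun i => linearForm φ * C (z i)) (pderiv i F) = 0 := fun i => by
        rw [aeval_mul_C_of_isHomogeneous hF.pderiv, h, map_zero, mul_zero]
      simp only [h2, aeval_mul_C_of_isHomogeneous hF, h0, aeval_X_left_apply] at h1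
      simpa using h1
    · have h3 : X i - linearForm φ * C (z i) =
          linearForm (LinearMap.proj i - z i • φ) :=
        MvPolynomial.funext fun x => by simp [mul_comm]
      rw [h3]
      exact linearForm_mem_linIdeal _ (by simpa [mul_comm] using hφ i)

end LinearIdeals

section NormalForm

variable {K : Type} [Field K] {k d : ℕ}

theorem derivation_mem_pow {R A : Type*} [CommRing R] [CommRing A] [Algebra R A]
    (D : Derivation R A A)
    (I : Ideal A) (h : ∀ a ∈ I, D a ∈ I) (d : ℕ) : ∀ a ∈ I ^ d, D a ∈ I ^ d := by
  induction d with
  | zero => simp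
  | succ d ih =>
    intro a ha
    rw [pow_succ] at ha ⊢
    refine Submodule.mul_induction_on ha (fun x hx y hy => ?_) fun x y hx hy => ?_
    · rw [Derivation.leibniz, smul_eq_mul, smul_eq_mul, mul_comm y]
      exact add_mem (Ideal.mul_mem_mul hx (h y hy)) (Ideal.mul_mem_mul (ih x hx) hy)
    · rw [map_add]
      exact add_mem hx hy

theorem linIdeal_le_idealOfVars {n : ℕ} (S : Set (Fin n → K)) :
    linIdeal K S ≤ idealOfVars (Fin n) K := by
  refine Ideal.span_le.mpr ?_
  rintro f ⟨hf, -⟩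
  rw [homogeneousSubmodule_one_eq_span_X] at hf
  exact Submodule.span_le_restrictScalars K (MvPolynomial (Fin n) K) _ hf

theorem pderiv_mem_linIdeal_single {n : ℕ} (i : Fin n) (F : MvPolynomial (Fin n) K)
    (hF : F ∈ linIdeal K {Pi.single i 1}) :
    pderiv i F ∈ linIdeal K {(Pi.single i 1 : Fin n → K)} := by
  refine Submodule.span_induction ?_ ?_ ?_ ?_ hF
  · rintro f ⟨hf, hf0⟩
    obtain ⟨c, rfl⟩ : ∃ c : Fin n → K, ∑ j, c j • X j = f := by
      rwa [← Submodule.mem_span_range_iff_exists_fun, ← homogeneousSubmodule_one_eq_span_X]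
    have hc : c i = 0 := by simpa [smul_eval, Pi.single_apply] using hf0
    simp [pderiv_X, Pi.single_apply, hc]
  · simp
  · intro x y _ _ hx hy
    simpa using add_mem hx hy
  · intro a x hx h
    rw [smul_eq_mul, Derivation.leibniz, smul_eq_mul, smul_eq_mul]
    exact add_mem (Ideal.mul_mem_left _ _ h) (Ideal.mul_mem_right _ _ hx)

theorem coeff_eq_zero_of_mem_linIdeal_single_pow [CharZero K] {n : ℕ} (i : Fin n)
    {F : MvPolynomial (Fin n) K} (hF : F.IsHomogeneous (d + 1))
    (h : F ∈ linIdeal K {Pi.single i 1} ^ d) (e : Fin n →₀ ℕ) (he : 2 ≤ e i) :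
    coeff e F = 0 := by
  have h1 := derivation_mem_pow (pderiv (R := K) i) _ (pderiv_mem_linIdeal_single i) d
  have h2 := Ideal.pow_right_mono (linIdeal_le_idealOfVars _) d (h1 _ (h1 _ h))
  rw [mem_pow_idealOfVars_iff'] at h2
  by_contra hne
  obtain ⟨e', rfl⟩ := exists_add_of_le (Finsupp.single_le_iff.mpr he)
  have hdeg := hF hne
  have h3 := h2 e' ?_
  · rw [coeff_pderiv, coeff_pderiv, add_assoc, ← Finsupp.single_add, add_comm e'] at h3
    have h4 : (e' i + 1 : K) ≠ 0 := by exact_mod_cast (e' i).succ_ne_zero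
    have h5 : (e' i + 1 + 1 : K) ≠ 0 := by exact_mod_cast (e' i + 1).succ_ne_zero
    simp [h4, h5] at h3
    exact hne h3
  · rw [map_add, Finsupp.weight_single] at hdeg
    have hw : Finsupp.degree e' = Finsupp.weight 1 e' :=
      DFunLike.congr_fun Finsupp.degree_eq_weight_one e'
    simp at hdeg
    omega

theorem X_dvd_of_forall_eval [Infinite K] (l : Fin k) (F : MvPolynomial (Fin k) K)
    (h : ∀ y : Fin k → K, y l = 0 → eval y F = 0) : X l ∣ F := by
  have hF : F ∈ linIdeal K {y : Fin k → K | y l = 0} := by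
    refine mem_linIdeal_iff.mpr fun x hx => h x ?_
    exact (Submodule.span_le (p := LinearMap.ker (LinearMap.proj (R := K) l))).mpr
      (fun y hy => by simpa using hy) hx
  rw [← Ideal.mem_span_singleton]
  refine Ideal.span_le.mpr ?_ hF
  rintro f ⟨hf, hf0⟩
  obtain ⟨c, rfl⟩ : ∃ c : Fin k → K, ∑ j, c j • X j = f := by
    rwa [← Submodule.mem_span_range_iff_exists_fun, ← homogeneousSubmodule_one_eq_span_X]
  refine sum_mem fun j _ => ?_
  by_cases hj : j = l
  · rw [hj, smul_eq_C_mul]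
    exact Ideal.mul_mem_left _ _ (Ideal.mem_span_singleton_self _)
  · have hc := hf0 (Pi.single j 1) (by simp [Ne.symm hj])
    have hc' : c j = 0 := by simpa [smul_eval, Pi.single_apply] using hc
    simp [hc']

theorem isHomogeneous_of_X_mul (l : Fin k) {F : MvPolynomial (Fin k) K}
    (h : (X l * F).IsHomogeneous (d + 1)) : F.IsHomogeneous d := by
  intro e he
  rw [← coeff_X_mul e l] at he
  have := h he
  rw [map_add, Finsupp.weight_single] at this
  simp at this
  omega

variable (K d) in
/-- The forms of degree `d + 1` of multiplicity at least `d` at the first coordinate point, that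
vanish on the span of the coordinate points other than the first one and that of index `l`. -/
def normalForm (l : Fin k) :
    homogeneousSubmodule (Fin k) K d × homogeneousSubmodule (Fin k) K d →ₗ[K]
      MvPolynomial (Fin (k + 1)) K :=
  LinearMap.coprod
    (LinearMap.mulLeft K (X 0) ∘ₗ (rename Fin.succ).toLinearMap ∘ₗ Submodule.subtype _)
    ((rename Fin.succ).toLinearMap ∘ₗ LinearMap.mulLeft K (X l) ∘ₗ Submodule.subtype _)

theorem normalForm_apply (l : Fin k) (x) : normalForm K d l x =
    X 0 * rename Fin.succ x.1.1 + rename Fin.succ (X l * x.2.1) := rfl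

theorem finSuccEquiv_rename_succ (F : MvPolynomial (Fin k) K) :
    finSuccEquiv K k (rename Fin.succ F) = Polynomial.C F := by
  induction F using MvPolynomial.induction_on with
  | C a =>
    rw [rename_C]
    exact (finSuccEquiv K k).commutes a
  | add p q hp hq => simp [hp, hq]
  | mul_X p i hp => rw [map_mul, map_mul, hp, rename_X, finSuccEquiv_X_succ, Polynomial.C_mul]

theorem normalForm_injective (l : Fin k) : Function.Injective (normalForm K d l) := by
  rw [← LinearMap.ker_eq_bot, LinearMap.ker_eq_bot']
  intro x hx
  rw [normalForm_apply] at hx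
  have h := congrArg (finSuccEquiv K k) hx
  rw [map_add, map_mul, finSuccEquiv_X_zero, finSuccEquiv_rename_succ, finSuccEquiv_rename_succ,
    map_zero] at h
  have h0 := congrArg (Polynomial.coeff · 0) h
  have h1 := congrArg (Polynomial.coeff · 1) h
  simp [Polynomial.coeff_C] at h0 h1
  exact Prod.ext h1 h0

theorem isHomogeneous_normalForm (l : Fin k) (x) : (normalForm K d l x).IsHomogeneous (d + 1) := by
  rw [normalForm_apply, add_comm d]
  refine IsHomogeneous.add ((isHomogeneous_X _ _).mul ?_) ?_
  · exact (x.1.2 : x.1.1.IsHomogeneous d).rename_isHomogeneous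
  · exact ((isHomogeneous_X _ _).mul (x.2.2 : x.2.1.IsHomogeneous d)).rename_isHomogeneous

theorem eval_normalForm (l : Fin k) (x) (z : Fin (k + 1) → K) : eval z (normalForm K d l x) =
    z 0 * eval (Fin.tail z) x.1.1 + z l.succ * eval (Fin.tail z) x.2.1 := by
  rw [normalForm_apply]
  simp [eval_rename, Fin.tail_def, Function.comp_def]

/-- The coordinate points of index not `0` and not `l.succ`. -/
def coordPoints (K : Type) [Field K] (l : Fin k) : Set (Fin (k + 1) → K) :=
  {x | ∃ i, i ≠ l ∧ x = Pi.single i.succ 1}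

theorem cons_mem_span_coordPoints (l : Fin k) {y : Fin k → K} (hy : y l = 0) :
    (Fin.cons 0 y : Fin (k + 1) → K) ∈ Submodule.span K (coordPoints K l) := by
  rw [pi_eq_sum_univ' (Fin.cons 0 y : Fin (k + 1) → K), Fin.sum_univ_succ]
  simp only [Fin.cons_zero, zero_smul, zero_add, Fin.cons_succ]
  refine sum_mem fun i _ => ?_
  by_cases hi : i = l
  · simp [hi, hy]
  · exact Submodule.smul_mem _ _ (Submodule.subset_span ⟨i, hi, rfl⟩)

theorem rename_succ_mem (F : MvPolynomial (Fin k) K) (e : ℕ) (hF : F.IsHomogeneous e) :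
    rename Fin.succ F ∈ linIdeal K {(Pi.single 0 1 : Fin (k + 1) → K)} ^ e := by
  have h : F ∈ idealOfVars (Fin k) K ^ e := by
    rw [mem_pow_idealOfVars_iff]
    intro x hx
    rw [Finsupp.degree_eq_weight_one]
    exact (hF (mem_support_iff.mp hx)).ge
  have h1 := Ideal.mem_map_of_mem (rename Fin.succ).toRingHom h
  rw [Ideal.map_pow] at h1
  refine Ideal.pow_right_mono ?_ e h1
  rw [idealOfVars, Ideal.map_span, Ideal.span_le]
  rintro _ ⟨_, ⟨i, rfl⟩, rfl⟩
  refine Ideal.subset_span ⟨?_, ?_⟩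
  · simpa using isHomogeneous_X K i.succ
  · simp

theorem exists_normalForm_iff [CharZero K] (l : Fin k) {F : MvPolynomial (Fin (k + 1)) K}
    (hF : F.IsHomogeneous (d + 1)) :
    (∃ x, normalForm K d l x = F) ↔
      F ∈ linIdeal K {Pi.single 0 1} ^ d ∧ F ∈ linIdeal K (coordPoints K l) := by
  constructor
  · rintro ⟨x, rfl⟩
    constructor
    · rw [normalForm_apply]
      refine add_mem (Ideal.mul_mem_left _ _ (rename_succ_mem _ _ x.1.2)) ?_
      rw [map_mul]
      exact Ideal.mul_mem_left _ _ (rename_succ_mem _ _ x.2.2)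
    · rw [mem_linIdeal_iff]
      intro z hz
      have hz' : z 0 = 0 ∧ z l.succ = 0 := by
        refine Submodule.span_induction (p := fun z _ => z 0 = 0 ∧ z l.succ = 0) ?_ ?_ ?_ ?_ hz
        · rintro _ ⟨i, hi, rfl⟩
          simp [hi.symm]
        · simp
        · rintro x y _ _ ⟨h1, h2⟩ ⟨h3, h4⟩
          simp [h1, h2, h3, h4]
        · rintro c x _ ⟨h1, h2⟩
          simp [h1, h2]
      simp [eval_normalForm, hz']
  · rintro ⟨h1, h2⟩
    have hdeg : (finSuccEquiv K k F).natDegree ≤ 1 := by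
      rw [natDegree_finSuccEquiv, degreeOf_le_iff]
      intro e he
      by_contra! hlt
      exact mem_support_iff.mp he (coeff_eq_zero_of_mem_linIdeal_single_pow 0 hF h1 e hlt)
    set A := (finSuccEquiv K k F).coeff 1 with hA
    set B := (finSuccEquiv K k F).coeff 0 with hB
    have hFAB : F = X 0 * rename Fin.succ A + rename Fin.succ B := by
      apply (finSuccEquiv K k).injective
      rw [map_add, map_mul, finSuccEquiv_X_zero, finSuccEquiv_rename_succ,
        finSuccEquiv_rename_succ, mul_comm]
      exact Polynomial.eq_X_add_C_of_natDegree_le_one hdeg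
    obtain ⟨B', hB'⟩ : X l ∣ B := by
      refine X_dvd_of_forall_eval l B fun y hy => ?_
      have := mem_linIdeal_iff.mp h2 _ (cons_mem_span_coordPoints l hy)
      rw [hFAB] at this
      simpa [eval_rename, Function.comp_def] using this
    have hAh : A.IsHomogeneous d := hF.finSuccEquiv_coeff_isHomogeneous 1 d (add_comm _ _)
    have hBh : B.IsHomogeneous (d + 1) :=
      hF.finSuccEquiv_coeff_isHomogeneous 0 (d + 1) (zero_add _)
    refine ⟨(⟨A, hAh⟩, ⟨B', isHomogeneous_of_X_mul l (hB' ▸ hBh)⟩), ?_⟩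
    rw [normalForm_apply]
    change X 0 * rename Fin.succ A + rename Fin.succ (X l * B') = F
    rw [← hB', ← hFAB]

end NormalForm

section Conditions

variable {K : Type} [Field K] {k d s t : ℕ}

theorem finrank_submodule_prod {V W : Type} [AddCommGroup V] [Module K V] [AddCommGroup W]
    [Module K W] [Module.Finite K V] [Module.Finite K W] (p : Submodule K V) (q : Submodule K W) :
    Module.finrank K (p.prod q) = Module.finrank K p + Module.finrank K q := by
  have h : LinearMap.range (p.subtype.prodMap q.subtype) = p.prod q := by
    rw [LinearMap.range_prodMap, p.range_subtype, q.range_subtype]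
  rw [← h, LinearMap.finrank_range_of_inj (p.injective_subtype.prodMap q.injective_subtype),
    Module.finrank_prod]

theorem eval_smul_of_isHomogeneous {n : ℕ} {F : MvPolynomial (Fin n) K} (hF : F.IsHomogeneous d)
    (c : K) (z : Fin n → K) : eval (c • z) F = c ^ d * eval z F := by
  have h := congrArg (eval z) (aeval_mul_C_of_isHomogeneous hF (C c) z)
  simp only [← C_mul] at h
  have h2 : aeval (fun i => (C (c * z i) : MvPolynomial (Fin n) K)) F = C (eval (c • z) F) :=
    (aeval_algebraMap_apply (MvPolynomial (Fin n) K) (fun i => c * z i) F)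
  rw [h2] at h
  simpa using h

theorem pderiv_zero_normalForm (l : Fin k) (x) :
    pderiv 0 (normalForm K d l x) = rename Fin.succ x.1.1 := by
  have h (F : MvPolynomial (Fin k) K) : pderiv 0 (rename Fin.succ F) = 0 :=
    pderiv_eq_zero_of_notMem_vars fun h0 => by
      obtain ⟨i, -, hi⟩ := Finset.mem_image.mp (vars_rename Fin.succ F h0)
      exact Fin.succ_ne_zero i hi
  rw [normalForm_apply, map_add, Derivation.leibniz, h, h]
  simp

theorem pderiv_succ_normalForm (l : Fin k) (x) (i : Fin k) :
    pderiv i.succ (normalForm K d l x) =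
      X 0 * rename Fin.succ (pderiv i x.1.1) + rename Fin.succ (pderiv i (X l * x.2.1)) := by
  rw [normalForm_apply, map_add, Derivation.leibniz, pderiv_rename (Fin.succ_injective k),
    pderiv_rename (Fin.succ_injective k), pderiv_X_of_ne (Fin.succ_ne_zero i).symm]
  simp

theorem normalForm_mem_linIdeal_pair_iff [CharZero K] (l : Fin k) (x) (w : Fin (k + 1) → K) :
    normalForm K d l x ∈ linIdeal K {Pi.single 0 1, w} ↔
      eval w (pderiv 0 (normalForm K d l x)) = 0 ∧ eval w (normalForm K d l x) = 0 := by
  have hA : eval w (pderiv 0 (normalForm K d l x)) = eval (Fin.tail w) x.1.1 := by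
    rw [pderiv_zero_normalForm, eval_rename]
    rfl
  rw [mem_linIdeal_iff, hA]
  constructor
  · intro h
    have h0 := h w (Submodule.subset_span (by simp))
    have h1 := h (Pi.single 0 1 + w) (add_mem (Submodule.subset_span (by simp))
      (Submodule.subset_span (by simp)))
    have ht : Fin.tail (Pi.single 0 1 + w : Fin (k + 1) → K) = Fin.tail w := by
      funext i
      simp [Fin.tail]
    refine ⟨?_, h0⟩
    rw [eval_normalForm] at h0 h1
    rw [ht] at h1
    simp at h1
    linear_combination h1 - h0
  · rintro ⟨h1, h2⟩ y hy
    obtain ⟨a, b, rfl⟩ := Submodule.mem_span_pair.mp hy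
    have ht : Fin.tail (a • Pi.single 0 1 + b • w : Fin (k + 1) → K) = b • Fin.tail w := by
      funext i
      simp [Fin.tail]
    rw [eval_normalForm, h1, mul_zero, zero_add] at h2
    rw [eval_normalForm, ht, eval_smul_of_isHomogeneous x.1.2, eval_smul_of_isHomogeneous x.2.2, h1]
    simp only [Pi.add_apply, Pi.smul_apply, smul_eq_mul,
      Pi.single_eq_of_ne (Fin.succ_ne_zero l)]
    linear_combination (b * b ^ d) * h2

/-- The conditions imposed on a form in normal form by double points and by lines through the
first coordinate point. -/
def conditions (l : Fin k) (z : Fin s → Fin (k + 1) → K) (w : Fin t → Fin (k + 1) → K) :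
    homogeneousSubmodule (Fin k) K d × homogeneousSubmodule (Fin k) K d →ₗ[K]
      (Fin s × Fin (k + 1) ⊕ Fin t ⊕ Fin t → K) :=
  (LinearMap.pi (Sum.elim (fun ji => evalLinear (z ji.1) ∘ₗ (pderiv ji.2).toLinearMap)
    (Sum.elim (fun j => evalLinear (w j) ∘ₗ (pderiv 0).toLinearMap)
      (fun j => evalLinear (w j))))) ∘ₗ normalForm K d l

theorem mem_ker_conditions (l : Fin k) (z : Fin s → Fin (k + 1) → K)
    (w : Fin t → Fin (k + 1) → K) (x) :
    x ∈ LinearMap.ker (conditions (d := d) l z w) ↔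
      (∀ j i, eval (z j) (pderiv i (normalForm K d l x)) = 0) ∧
      (∀ j, eval (w j) (pderiv 0 (normalForm K d l x)) = 0) ∧
      ∀ j, eval (w j) (normalForm K d l x) = 0 := by
  simp [conditions, _root_.funext_iff]

theorem mem_ker_conditions_iff_mem_linIdeal [CharZero K] (hd : 1 ≤ d) (l : Fin k)
    (z : Fin s → Fin (k + 1) → K) (w : Fin t → Fin (k + 1) → K) (x) :
    x ∈ LinearMap.ker (conditions (d := d) l z w) ↔
      (∀ j, normalForm K d l x ∈ linIdeal K {z j} ^ 2) ∧
      ∀ j, normalForm K d l x ∈ linIdeal K {Pi.single 0 1, w j} := by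
  simp only [mem_ker_conditions, normalForm_mem_linIdeal_pair_iff,
    mem_linIdeal_singleton_sq_iff (Nat.succ_le_succ hd) _ (isHomogeneous_normalForm l x),
    forall_and]

theorem finrank_piece_eq [CharZero K] (hd : 1 ≤ d) (l : Fin k)
    (T : (Fin (k + 1) → K) ≃ₗ[K] (Fin (k + 1) → K)) {c : K} (hc : c ≠ 0)
    (pt : Fin s → Fin (k + 1) → K) (w : Fin t → Fin (k + 1) → K) :
    Module.finrank K (piece K (linIdeal K {T (Pi.single 0 1)} ^ d ⊓
        linIdeal K (T '' coordPoints K l) ⊓ (⨅ i, linIdeal K {pt i} ^ 2) ⊓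
        ⨅ j, linIdeal K {T (Pi.single 0 1), w j}) (d + 1)) =
      Module.finrank K (LinearMap.ker (conditions (d := d) l (fun i => c • T.symm (pt i))
        (fun j => c • T.symm (w j)))) := by
  have hTs : ∀ F : MvPolynomial (Fin (k + 1)) K,
      linSubst T.toLinearMap (linSubst T.symm.toLinearMap F) = F := linSubst_symm_linSubst T.symm
  let f := (linSubst T.symm.toLinearMap).toLinearMap ∘ₗ normalForm K d l
  have hf : Function.Injective f :=
    (Function.LeftInverse.injective hTs).comp (normalForm_injective l)
  rw [LinearEquiv.finrank_eq (Submodule.equivMapOfInjective f hf _)]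
  refine congrArg
    (fun W : Submodule K (MvPolynomial (Fin (k + 1)) K) => Module.finrank K W) ?_
  have hmem : ∀ (D : ℕ) (S S' : Set (Fin (k + 1) → K)) (F : MvPolynomial (Fin (k + 1)) K),
      (∀ x ∈ S, T x ∈ Submodule.span K S') → (∀ x ∈ S', T.symm x ∈ Submodule.span K S) →
      (linSubst T.toLinearMap F ∈ linIdeal K S ^ D ↔ F ∈ linIdeal K S' ^ D) :=
    fun D S S' F h h' => linSubst_mem_pow_iff T h h'
  have h1 : ∀ F, F ∈ linIdeal K {T (Pi.single 0 1)} ^ d ↔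
      linSubst T.toLinearMap F ∈ linIdeal K {Pi.single 0 1} ^ d := fun F => by
    refine (hmem _ _ _ _ ?_ ?_).symm
    · rintro _ rfl
      exact Submodule.mem_span_singleton_self _
    · rintro _ rfl
      rw [T.symm_apply_apply]
      exact Submodule.mem_span_singleton_self _
  have h2 : ∀ F, F ∈ linIdeal K (T '' coordPoints K l) ↔
      linSubst T.toLinearMap F ∈ linIdeal K (coordPoints K l) := fun F => by
    have := hmem 1 (coordPoints K l) (T '' coordPoints K l) F ?_ ?_
    · simpa using this.symm
    · exact fun x hx => Submodule.subset_span ⟨x, hx, rfl⟩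
    · rintro _ ⟨x, hx, rfl⟩
      rw [T.symm_apply_apply]
      exact Submodule.subset_span hx
  have h3 : ∀ (y : Fin (k + 1) → K) F, F ∈ linIdeal K {y} ^ 2 ↔
      linSubst T.toLinearMap F ∈ linIdeal K {c • T.symm y} ^ 2 := fun y F => by
    refine (hmem _ _ _ _ ?_ ?_).symm
    · rintro _ rfl
      simpa using Submodule.smul_mem _ c (Submodule.mem_span_singleton_self y)
    · rintro _ rfl
      exact Submodule.mem_span_singleton.mpr ⟨c⁻¹, by rw [inv_smul_smul₀ hc]⟩
  have h4 : ∀ (y : Fin (k + 1) → K) F, F ∈ linIdeal K {T (Pi.single 0 1), y} ↔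
      linSubst T.toLinearMap F ∈ linIdeal K {Pi.single 0 1, c • T.symm y} := fun y F => by
    have := hmem 1 {Pi.single 0 1, c • T.symm y} {T (Pi.single 0 1), y} F ?_ ?_
    · simpa using this.symm
    · rintro _ (rfl | rfl)
      · exact Submodule.subset_span (by simp)
      · rw [map_smul, T.apply_symm_apply]
        exact Submodule.smul_mem _ c (Submodule.subset_span (by simp))
    · rintro x (rfl | rfl)
      · rw [T.symm_apply_apply]
        exact Submodule.subset_span (by simp)
      · have := Submodule.smul_mem (Submodule.span K {Pi.single 0 1, c • T.symm x}) c⁻¹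
          (Submodule.subset_span (Set.mem_insert_of_mem _ rfl))
        rwa [inv_smul_smul₀ hc] at this
  ext F
  simp only [piece, Submodule.mem_inf, Submodule.restrictScalars_mem, Ideal.mem_iInf,
    mem_homogeneousSubmodule, Submodule.mem_map, mem_ker_conditions_iff_mem_linIdeal hd]
  rw [h1, h2, forall_congr' fun i => h3 (pt i) F, forall_congr' fun j => h4 (w j) F]
  constructor
  · rintro ⟨⟨⟨⟨ha, hb⟩, hp⟩, hw⟩, hF⟩
    obtain ⟨x, hx⟩ := (exists_normalForm_iff l (isHomogeneous_linSubst T.toLinearMap hF)).mpr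
      ⟨ha, hb⟩
    refine ⟨x, by simpa only [hx] using ⟨hp, hw⟩, ?_⟩
    change linSubst T.symm.toLinearMap (normalForm K d l x) = F
    rw [hx, linSubst_symm_linSubst]
  · rintro ⟨x, ⟨hp, hw⟩, rfl⟩
    have hx : linSubst T.toLinearMap (f x) = normalForm K d l x := hTs _
    have h := (exists_normalForm_iff l (isHomogeneous_normalForm l x)).mp ⟨x, rfl⟩
    rw [hx]
    exact ⟨⟨⟨h, hp⟩, hw⟩, isHomogeneous_linSubst _ (isHomogeneous_normalForm l x)⟩

theorem le_finrank_ker_conditions (l : Fin k) (z : Fin s → Fin (k + 1) → K)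
    (w : Fin t → Fin (k + 1) → K) :
    2 * k.multichoose d ≤ Module.finrank K (LinearMap.ker (conditions (d := d) l z w)) +
      (s * (k + 1) + 2 * t) := by
  have h := LinearMap.finrank_range_add_finrank_ker (conditions (d := d) l z w)
  have h2 := Submodule.finrank_le (LinearMap.range (conditions (d := d) l z w))
  rw [Module.finrank_prod, finrank_homogeneousSubmodule] at h
  simp at h2
  omega

theorem eval_eq_zero_of_gradient_normalForm [CharZero K] (l : Fin k) (x) (z : Fin (k + 1) → K)
    (hz : ∀ i, eval z (pderiv i (normalForm K d l x)) = 0) (hl : z l.succ ≠ 0) :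
    eval (Fin.tail z) x.1.1 = 0 ∧ eval (Fin.tail z) x.2.1 = 0 ∧
      ∀ i, z 0 * eval (Fin.tail z) (pderiv i x.1.1) +
        z l.succ * eval (Fin.tail z) (pderiv i x.2.1) = 0 := by
  have hr (F : MvPolynomial (Fin k) K) : eval z (rename Fin.succ F) = eval (Fin.tail z) F := by
    rw [eval_rename]
    rfl
  have hA : eval (Fin.tail z) x.1.1 = 0 := by
    have := hz 0
    rwa [pderiv_zero_normalForm, hr] at this
  have hB : eval (Fin.tail z) x.2.1 = 0 := by
    have h := congrArg (eval z) (isHomogeneous_normalForm l x).sum_X_mul_pderiv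
    have h0 : (d + 1 : K) ≠ 0 := by exact_mod_cast d.succ_ne_zero
    have h1 : eval z (normalForm K d l x) = 0 := by
      simpa [hz, h0] using h
    rw [eval_normalForm, hA, mul_zero, zero_add] at h1
    exact (mul_eq_zero.mp h1).resolve_left hl
  refine ⟨hA, hB, fun i => ?_⟩
  have h := hz i.succ
  rw [pderiv_succ_normalForm, map_add, map_mul, eval_X, hr, hr, Derivation.leibniz] at h
  simpa [hB, Fin.tail] using h

variable (K) in
theorem exists_finrank_ker_conditions_le [CharZero K] (hd : 3 ≤ d) (l : Fin k) (q t : ℕ)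
    (hs : s = 2 * q) :
    ∃ (z : Fin s → Fin (k + 1) → K) (w : Fin t → Fin (k + 1) → K),
      Module.finrank K (LinearMap.ker (conditions (d := d) l z w)) ≤
        2 * (k.multichoose d - q * (k + 1) - t) := by
  obtain ⟨p, p', w, h1, h2, hp, hp', hw⟩ := exists_symmetric_configuration K hd l q t
  obtain rfl : s = q + q := by omega
  let z : Fin (q + q) → Fin (k + 1) → K :=
    Fin.append (fun j => Fin.cons 0 (p j)) (fun j => Fin.cons (p' j l) (p' j))
  let w' : Fin t → Fin (k + 1) → K := fun j => Fin.cons 0 (w j)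
  refine ⟨z, w', ?_⟩
  let φ : homogeneousSubmodule (Fin k) K d × homogeneousSubmodule (Fin k) K d →ₗ[K]
      homogeneousSubmodule (Fin k) K d × homogeneousSubmodule (Fin k) K d :=
    (LinearMap.snd K _ _).prod (LinearMap.fst K _ _ + LinearMap.snd K _ _)
  refine (finrank_le_of_injOn (T := (LinearMap.ker (formConditions (d := d) p p' w)).prod
    (LinearMap.ker (formConditions (d := d) p' p w))) φ ?_ ?_).trans ?_
  · rintro ⟨A, B⟩ - h
    have h' : B = 0 ∧ A + B = 0 := by simpa [φ] using h
    simpa [h'.1] using h'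
  · rintro ⟨A, B⟩ hx
    rw [mem_ker_conditions] at hx
    obtain ⟨hz, hw0, hw1⟩ := hx
    have hz1 (j : Fin q) : z (Fin.castAdd q j) = Fin.cons 0 (p j) := Fin.append_left ..
    have hz2 (j : Fin q) : z (Fin.natAdd q j) = Fin.cons (p' j l) (p' j) := Fin.append_right ..
    have hzp := fun j => eval_eq_zero_of_gradient_normalForm l _ (Fin.cons 0 (p j))
      (hz1 j ▸ hz (Fin.castAdd q j)) (hp j)
    have hzp' := fun j => eval_eq_zero_of_gradient_normalForm l _ (Fin.cons (p' j l) (p' j))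
      (hz2 j ▸ hz (Fin.natAdd q j)) (hp' j)
    have hA : ∀ j, eval (w j) A.1 = 0 := fun j => by
      have := hw0 j
      rw [pderiv_zero_normalForm, eval_rename] at this
      exact this
    have hB : ∀ j, eval (w j) B.1 = 0 := fun j => by
      have := hw1 j
      rw [eval_normalForm] at this
      simpa [w', hw j] using this
    simp only [Fin.tail_cons, Fin.cons_zero, Fin.cons_succ, zero_mul, zero_add, mul_eq_zero]
      at hzp hzp'
    simp only [Submodule.mem_prod, mem_ker_formConditions, φ]
    refine ⟨⟨fun j i => ?_, fun j => (hzp' j).2.1, hB⟩, fun j i => ?_, fun j => ?_, fun j => ?_⟩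
    · exact ((hzp j).2.2 i).resolve_left (hp j)
    · refine mul_left_cancel₀ (hp' j) ?_
      simpa [mul_add] using (hzp' j).2.2 i
    · simp [(hzp j).1, (hzp j).2.1]
    · simp [hA, hB]
  · rw [finrank_submodule_prod]
    omega

end Conditions

section Generic

variable {K : Type} [Field K]

/-- The matrix whose columns are the points `P 0, …, P (k - 1)` and the last coordinate point. -/
def frame (k : ℕ) (P : ℕ → ℕ → K) : Matrix (Fin (k + 1)) (Fin (k + 1)) K :=
  Matrix.of fun c r => if r = Fin.last k then if c = r then 1 else 0 else P r c

/-- The algebra of polynomial functions of the coordinates of a sequence of points. -/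
def coordinateAlgebra (K : Type) [Field K] : Subalgebra K ((ℕ → ℕ → K) → K) :=
  (aeval fun ij : ℕ × ℕ => fun P : ℕ → ℕ → K => P ij.1 ij.2).range

theorem aeval_coord_apply (g : MvPolynomial (ℕ × ℕ) K) (P : ℕ → ℕ → K) :
    (aeval fun ij : ℕ × ℕ => fun P : ℕ → ℕ → K => P ij.1 ij.2) g P =
      eval (fun ij => P ij.1 ij.2) g := by
  have h := comp_aeval_apply (R := K) (fun ij : ℕ × ℕ => fun P : ℕ → ℕ → K => P ij.1 ij.2)
    (Pi.evalAlgHom K (fun _ : ℕ → ℕ → K => K) P) g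
  simpa [aeval_eq_eval] using h

theorem coord_mem (i j : ℕ) :
    (fun P : ℕ → ℕ → K => P i j) ∈ coordinateAlgebra K :=
  ⟨X (i, j), by simp⟩

theorem frame_mem (k : ℕ) (c r) :
    (fun P : ℕ → ℕ → K => frame k P c r) ∈ coordinateAlgebra K := by
  unfold frame
  simp only [Matrix.of_apply]
  by_cases h : r = Fin.last k
  · simp only [if_pos h]
    exact (coordinateAlgebra K).algebraMap_mem _
  · simp only [if_neg h]
    exact coord_mem _ _

theorem det_mem {X ι : Type*} [Fintype ι] [DecidableEq ι] (A : Subalgebra K (X → K))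
    {M : X → Matrix ι ι K} (hM : ∀ i j, (fun x => M x i j) ∈ A) : (fun x => (M x).det) ∈ A := by
  have h : (fun x => (M x).det) =
      ∑ σ : Equiv.Perm ι, ((Equiv.Perm.sign σ : ℤ) : K) • ∏ i, fun x => M x (σ i) i := by
    funext x
    simp [Matrix.det_apply', Finset.sum_apply, Finset.prod_apply]
  rw [h]
  exact A.sum_mem fun σ _ => A.smul_mem (A.prod_mem fun i _ => hM _ _) _

theorem adjugate_mem {X ι : Type*} [Fintype ι] [DecidableEq ι] (A : Subalgebra K (X → K))
    {M : X → Matrix ι ι K} (hM : ∀ i j, (fun x => M x i j) ∈ A) (i j : ι) :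
    (fun x => (M x).adjugate i j) ∈ A := by
  simp only [Matrix.adjugate_apply]
  refine det_mem A fun i' j' => ?_
  simp only [Matrix.updateRow_apply]
  split_ifs with h
  · exact A.algebraMap_mem _
  · exact hM _ _

theorem mulVec_adjugate_mem {X ι : Type*} [Fintype ι] [DecidableEq ι] (A : Subalgebra K (X → K))
    {M : X → Matrix ι ι K} (hM : ∀ i j, (fun x => M x i j) ∈ A) {v : X → ι → K}
    (hv : ∀ i, (fun x => v x i) ∈ A) (i : ι) :
    (fun x => ((M x).adjugate.mulVec (v x)) i) ∈ A := by
  have h : (fun x => ((M x).adjugate.mulVec (v x)) i) =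
      ∑ j, (fun x => (M x).adjugate i j) * fun x => v x j := by
    funext x
    simp [Matrix.mulVec, dotProduct, Finset.sum_apply]
  rw [h]
  exact A.sum_mem fun j _ => A.mul_mem (adjugate_mem A hM i j) (hv j)

theorem conditions_apply_mem {X : Type*} {k d s t : ℕ} (A : Subalgebra K (X → K)) (l : Fin k)
    {z : X → Fin s → Fin (k + 1) → K} {w : X → Fin t → Fin (k + 1) → K}
    (hz : ∀ i c, (fun x => z x i c) ∈ A) (hw : ∀ j c, (fun x => w x j c) ∈ A) (F i) :
    (fun x => conditions (d := d) l (z x) (w x) F i) ∈ A := by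
  rcases i with ⟨i, c⟩ | j | j
  · exact eval_mem_subalgebra A (fun c x => z x i c) (hz i) (pderiv c (normalForm K d l F))
  · exact eval_mem_subalgebra A (fun c x => w x j c) (hw j) (pderiv 0 (normalForm K d l F))
  · exact eval_mem_subalgebra A (fun c x => w x j c) (hw j) (normalForm K d l F)

theorem finrank_piece_eq_adjugate [CharZero K] {k d s t : ℕ} (hd : 1 ≤ d) (l : Fin k)
    (M : Matrix (Fin (k + 1)) (Fin (k + 1)) K) (hM : M.det ≠ 0)
    (pt : Fin s → Fin (k + 1) → K) (w : Fin t → Fin (k + 1) → K) :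
    Module.finrank K (piece K (linIdeal K {M.col 0} ^ d ⊓
        linIdeal K (M.mulVec '' coordPoints K l) ⊓ (⨅ i, linIdeal K {pt i} ^ 2) ⊓
        ⨅ j, linIdeal K {M.col 0, w j}) (d + 1)) =
      Module.finrank K (LinearMap.ker (conditions (d := d) l (fun i => M.adjugate.mulVec (pt i))
        (fun j => M.adjugate.mulVec (w j)))) := by
  have hu : IsUnit M.det := hM.isUnit
  obtain ⟨T, hT, hT'⟩ : ∃ T : (Fin (k + 1) → K) ≃ₗ[K] (Fin (k + 1) → K),
      (∀ x, T x = M.mulVec x) ∧ ∀ x, T.symm x = M⁻¹.mulVec x :=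
    ⟨Matrix.toLin'OfInv (Matrix.nonsing_inv_mul M hu) (Matrix.mul_nonsing_inv M hu),
      fun x => by simp [Matrix.toLin'OfInv], fun x => by simp [Matrix.toLin'OfInv]⟩
  have h := finrank_piece_eq hd l T hM pt w
  have h0 : M.mulVec (Pi.single 0 1) = M.col 0 := Matrix.mulVec_single_one ..
  have h1 (x) : M.det • T.symm x = M.adjugate.mulVec x := by
    rw [hT', ← Matrix.smul_mulVec, Matrix.inv_def, smul_smul, Ring.mul_inverse_cancel _ hu,
      one_smul]
  rwa [show ⇑T = M.mulVec from funext hT, h0, funext fun i => h1 (pt i), funext fun j => h1 (w j)] at h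

theorem frame_col_of_ne {k : ℕ} (P : ℕ → ℕ → K) {r : Fin (k + 1)} (hr : r ≠ Fin.last k) :
    (frame k P).col r = fun c : Fin (k + 1) => P r c := by
  funext c
  simp [frame, Matrix.col, hr]

theorem frame_mulVec_image_coordPoints {m : ℕ} (P : ℕ → ℕ → K) :
    (frame (1 + m) P).mulVec '' coordPoints K (⟨m, by omega⟩ : Fin (1 + m)) =
      Set.range fun (i : Fin m) (c : Fin (1 + m + 1)) => P (1 + i) c := by
  ext x
  constructor
  · rintro ⟨_, ⟨i, hi, rfl⟩, rfl⟩
    have hi' : (i : ℕ) ≠ m := fun h => hi (Fin.ext h)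
    refine ⟨⟨i, by omega⟩, ?_⟩
    rw [Matrix.mulVec_single_one, frame_col_of_ne]
    · simp [add_comm]
    · simp only [ne_eq, Fin.ext_iff, Fin.val_succ, Fin.val_last]
      omega
  · rintro ⟨i, rfl⟩
    refine ⟨_, ⟨⟨i, by omega⟩, ?_, rfl⟩, ?_⟩
    · simp only [ne_eq, Fin.mk.injEq]
      omega
    · rw [Matrix.mulVec_single_one, frame_col_of_ne]
      · simp [add_comm]
      · simp only [ne_eq, Fin.ext_iff, Fin.val_succ, Fin.val_last]
        omega

end Generic

/-- **(Base case `n = 1` of the main theorem.)**  Let `d ≥ 3`, `m ≥ 1`, `q, t ∈ ℕ` and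
`s = 2q`.  For a generic configuration in `P^{1+m}` of: a point `H₁`, a linear space
`H₂ ≅ P^{m-1}`, `t` lines `Wⱼ = ⟨H₁, wⱼ⟩` through `H₁`, and `s` points `pt₁,…,pt_s`,
the scheme `X = dH₁ + H₂ + 2pt₁ + ⋯ + 2pt_s + W₁ + ⋯ + W_t` satisfies
`dim (I_X)_{d+1} = max { 2·C(m+d,d) − 2q(m+2) − 2t ; 0 }`. -/
theorem stmt16 (K : Type) [Field K] [IsAlgClosed K] [CharZero K]
    (m d q t : ℕ) (hd : 3 ≤ d) (hm : 1 ≤ m)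
    (s : ℕ) (hs : s = 2 * q) :
    ∃ g : MvPolynomial (ℕ × ℕ) K, g ≠ 0 ∧
      ∀ P : ℕ → ℕ → K, MvPolynomial.eval (fun ij => P ij.1 ij.2) g ≠ 0 →
        let a : Fin (1 + m + 1) → K := fun c => P 0 (c : ℕ)                 -- H₁, a point
        let b : Fin m → (Fin (1 + m + 1) → K) := fun i c => P (1 + (i : ℕ)) (c : ℕ)  -- H₂
        let w : Fin t → (Fin (1 + m + 1) → K) := fun i c => P (1 + m + (i : ℕ)) (c : ℕ)
        let pt : Fin s → (Fin (1 + m + 1) → K) := fun i c => P (1 + m + t + (i : ℕ)) (c : ℕ)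
        let IX : Ideal (MvPolynomial (Fin (1 + m + 1)) K) :=
          (linIdeal K {a}) ^ d ⊓ linIdeal K (Set.range b)
            ⊓ (⨅ i : Fin s, (linIdeal K {pt i}) ^ 2)
            ⊓ (⨅ j : Fin t, linIdeal K {a, w j})
        (Module.finrank K (piece K IX (d + 1)) : ℤ)
          = max (2 * ((m + d).choose d) - 2 * q * (m + 2) - 2 * t : ℤ) 0 := by
  let l : Fin (1 + m) := ⟨m, by omega⟩
  obtain ⟨z₀, w₀, h₀⟩ := exists_finrank_ker_conditions_le K hd l q t hs
  let w (P : ℕ → ℕ → K) (i : Fin t) (c : Fin (1 + m + 1)) : K := P (1 + m + i) c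
  let pt (P : ℕ → ℕ → K) (i : Fin s) (c : Fin (1 + m + 1)) : K := P (1 + m + t + i) c
  let f (P : ℕ → ℕ → K) := conditions (d := d) l
    (fun i => (frame (1 + m) P).adjugate.mulVec (pt P i))
    (fun j => (frame (1 + m) P).adjugate.mulVec (w P j))
  let P₀ : ℕ → ℕ → K := fun r c =>
    if r < 1 + m then if c = r then 1 else 0
    else if hr : r - (1 + m) < t then if hc : c < 1 + m + 1 then w₀ ⟨_, hr⟩ ⟨c, hc⟩ else 0
    else if hr : r - (1 + m + t) < s then if hc : c < 1 + m + 1 then z₀ ⟨_, hr⟩ ⟨c, hc⟩ else 0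
    else 0
  have hM₀ : frame (1 + m) P₀ = 1 := by
    ext c r
    by_cases hr : r = Fin.last (1 + m)
    · simp [frame, hr, Matrix.one_apply]
    · have hr' : (r : ℕ) < 1 + m := by
        have := Fin.val_ne_of_ne hr
        rw [Fin.val_last] at this
        omega
      simp [frame, Matrix.one_apply, P₀, hr', Fin.ext_iff]
  have hw₀ : w P₀ = w₀ := by
    funext i c
    simp [w, P₀, c.is_le]
  have hpt₀ : pt P₀ = z₀ := by
    funext i c
    have h1 : ¬ 1 + m + t + (i : ℕ) < 1 + m := by omega
    have h2 : ¬ 1 + m + t + (i : ℕ) - (1 + m) < t := by omega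
    simp [pt, P₀, h1, h2, c.is_le]
  have hf₀ : f P₀ = conditions l z₀ w₀ := by
    simp [f, hM₀, hw₀, hpt₀]
  obtain ⟨_, ⟨g, rfl⟩, hg₀, hg⟩ := exists_mem_finrank_ker_le (coordinateAlgebra K) f
    (fun F i => conditions_apply_mem _ l
      (fun i => mulVec_adjugate_mem _ (frame_mem (1 + m)) fun c => coord_mem _ _)
      (fun i => mulVec_adjugate_mem _ (frame_mem (1 + m)) fun c => coord_mem _ _) F i) P₀
  obtain ⟨D, hD⟩ := det_mem (coordinateAlgebra K) (frame_mem (K := K) (1 + m))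
  have hD' (P : ℕ → ℕ → K) : eval (fun ij => P ij.1 ij.2) D = (frame (1 + m) P).det :=
    (aeval_coord_apply D P).symm.trans (congrFun hD P)
  refine ⟨D * g, fun h => ?_, fun P hP => ?_⟩
  · have h1 := congrArg (eval fun ij : ℕ × ℕ => P₀ ij.1 ij.2) h
    rw [map_mul, hD', hM₀, Matrix.det_one, one_mul, map_zero] at h1
    exact hg₀ ((aeval_coord_apply g P₀).trans h1)
  · rw [map_mul, hD'] at hP
    have hle := hg P ((aeval_coord_apply g P).trans_ne (right_ne_zero_of_mul hP))
    rw [hf₀] at hle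
    have hge := le_finrank_ker_conditions (d := d) l
      (fun i => (frame (1 + m) P).adjugate.mulVec (pt P i))
      (fun j => (frame (1 + m) P).adjugate.mulVec (w P j))
    have heq := finrank_piece_eq_adjugate (d := d) (by omega) l _ (left_ne_zero_of_mul hP)
      (pt P) (w P)
    rw [frame_mulVec_image_coordPoints, frame_col_of_ne P (r := 0) 
      (by simp only [ne_eq, Fin.ext_iff, Fin.val_zero, Fin.val_last]; omega)] at heq
    have hc : (1 + m).multichoose d = (m + d).choose d := by
      rw [Nat.multichoose_eq]
      congr 1
      omega
    intro a b w' pt' IX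
    have heq' : Module.finrank K (piece K IX (d + 1)) = Module.finrank K (LinearMap.ker (f P)) :=
      heq
    rw [heq']
    have hle' := hle.trans h₀
    change _ ≤ Module.finrank K (LinearMap.ker (f P)) + _ at hge
    rw [hc] at hle' hge
    generalize Module.finrank K (LinearMap.ker (f P)) = n at *
    obtain ⟨u, hu⟩ : ∃ u, u = q * (m + 2) := ⟨_, rfl⟩
    rw [show q * (1 + m + 1) = u by rw [hu]; ring] at hle'
    rw [show s * (1 + m + 1) = 2 * u by rw [hu, hs]; ring] at hge
    rw [show (2 * q * (m + 2) : ℤ) = 2 * u by rw [hu]; push_cast; ring]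
    omega
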